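/- Let p > 3 be a prime with p ≡ 3 (mod 4), let h be the class number of ℚ(√-p), and let r, s, t be integers with 0 < r, s, t < p and r + s + t = p. Set Φ = {a : 1 ≤ a ≤ p-1, ⟨ar/p⟩ + ⟨as/p⟩ + ⟨at/p⟩ = 1}, u = #{a ∈ Φ : (a|p) = +1}, and v = #{a ∈ Φ : (a|p) = -1}. Then u - v = h·((r|p) + (s|p) + (t|p)). -/

import Mathlib

open Polynomial in
/-- In `(ℤ/p)[X]`, a difference of monomials is `X - 1` times a polynomial whose value at `1` is
the difference of the exponents. -/
lemma exists_X_pow_sub_X_pow_eq_mul {R : Type*} [CommRing R] (a b : ℕ) :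
    ∃ q : R[X], X ^ a - X ^ b = (X - 1) * q ∧ q.eval 1 = a - b := by
  refine ⟨(∑ i ∈ Finset.range a, X ^ i) - ∑ i ∈ Finset.range b, X ^ i, ?_, ?_⟩
  · rw [mul_comm, sub_mul, geom_sum_mul, geom_sum_mul]; ring
  · simp [eval_finsetSum]

open Polynomial in
lemma coeff_taylor_one_X_sub_one_pow_mul {R : Type*} [CommRing R] (m : ℕ) (g : R[X]) :
    (taylor 1 ((X - 1) ^ m * g)).coeff m = g.eval 1 := by
  have h : taylor 1 ((X - 1 : R[X]) ^ m) = X ^ m := by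
    rw [taylor_pow]; congr 1; simp [taylor_X]
  rw [taylor_mul, h, coeff_X_pow_mul', if_pos le_rfl, Nat.sub_self, taylor_coeff_zero]

open Polynomial in
/-- The sum of a monic polynomial of degree `#F - 1` over a finite field `F` is `-1`. -/
lemma sum_eval_of_monic_of_natDegree {F : Type*} [Field F] [Fintype F] {f : F[X]}
    (hf : f.Monic) (hd : f.natDegree = Fintype.card F - 1) :
    ∑ x, f.eval x = -1 := by
  classical
  have hc : 0 < Fintype.card F - 1 := Nat.sub_pos_of_lt Fintype.one_lt_card
  simp_rw [eval_eq_sum_range]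
  rw [Finset.sum_comm, Finset.sum_range_succ, Finset.sum_eq_zero, zero_add]
  · rw [hf.coeff_natDegree, hd]
    simp only [one_mul]
    have h1 : ∀ x : F, x ^ (Fintype.card F - 1) = if x = 0 then 0 else 1 := fun x ↦ by
      split_ifs with h
      · rw [h, zero_pow hc.ne']
      · exact FiniteField.pow_card_sub_one_eq_one x h
    simp_rw [h1]
    rw [Finset.sum_ite]
    simp [Finset.filter_ne', Finset.card_univ,
      Nat.cast_sub (Nat.one_le_of_lt hc |>.trans (Nat.sub_le _ _))]
  · intro i hi
    rw [← Finset.mul_sum, FiniteField.sum_pow_lt_card_sub_one F i (by simpa [hd] using hi),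
      mul_zero]

lemma sum_range_natCast_zmod {M : Type*} [AddCommMonoid M] (p : ℕ) [NeZero p] (f : ZMod p → M) :
    ∑ a ∈ Finset.range p, f a = ∑ x, f x := by
  refine Finset.sum_bij (fun a _ ↦ (a : ZMod p)) (by simp) ?_ ?_ (by simp)
  · intro a ha b hb h
    have := (ZMod.natCast_eq_natCast_iff' a b p).mp h
    rwa [Nat.mod_eq_of_lt (Finset.mem_range.mp ha), Nat.mod_eq_of_lt (Finset.mem_range.mp hb)]
      at this
  · intro x _
    exact ⟨x.val, Finset.mem_range.mpr (ZMod.val_lt x), by simp⟩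

lemma factorial_mul_prod_odd (m : ℕ) :
    m.factorial * ∏ k ∈ Finset.range m, (4 * k + 2) = (2 * m).factorial := by
  induction m with
  | zero => simp
  | succ m ih =>
    rw [Finset.prod_range_succ, show 2 * (m + 1) = 2 * m + 1 + 1 by ring, Nat.factorial_succ,
      Nat.factorial_succ, Nat.factorial_succ, ← ih]
    ring

open Polynomial in
/-- If `∑ (a|p) X ^ a` and `ε ∏ (X ^ (2 * k + 1) - X ^ -(2 * k + 1))` agree modulo
`(X - 1) ^ (p - 1)` over `ℤ/p`, then `ε = 1`. -/
lemma eq_one_of_X_sub_one_pow_dvd {p m : ℕ} [Fact p.Prime] (hm : p = 2 * m + 1) (hm0 : 0 < m)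
    (ε : ZMod p)
    (h : (X - 1 : (ZMod p)[X]) ^ (p - 1) ∣
      (∑ a ∈ Finset.range p, C ((quadraticChar (ZMod p) a : ℤ) : ZMod p) * X ^ a)
        - C ε * ∏ k ∈ Finset.range m, (X ^ (2 * k + 1) - X ^ (p - (2 * k + 1)))) :
    ε = 1 := by
  have hp : p.Prime := Fact.out
  obtain ⟨g, hg⟩ := h
  choose q hq hq1 using fun k : ℕ ↦
    exists_X_pow_sub_X_pow_eq_mul (R := ZMod p) (2 * k + 1) (p - (2 * k + 1))
  have h0 : (taylor 1 ((X - 1 : (ZMod p)[X]) ^ (p - 1) * g)).coeff m = 0 := by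
    rw [show p - 1 = m + m by omega, pow_add, mul_assoc, coeff_taylor_one_X_sub_one_pow_mul]
    simp [hm0.ne']
  simp_rw [← hg, hq, Finset.prod_mul_distrib, Finset.prod_const, Finset.card_range] at h0
  rw [mul_left_comm, map_sub, coeff_sub, coeff_taylor_one_X_sub_one_pow_mul, eval_mul, eval_C,
    eval_prod, sub_eq_zero] at h0
  have hprod : (m.factorial : ZMod p) * ∏ k ∈ Finset.range m, (q k).eval 1 = -1 := by
    have : ∏ k ∈ Finset.range m, (q k).eval 1 =
        ((∏ k ∈ Finset.range m, (4 * k + 2) : ℕ) : ZMod p) := by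
      rw [Nat.cast_prod]
      refine Finset.prod_congr rfl fun k hk ↦ ?_
      rw [hq1, Nat.cast_sub (by have := Finset.mem_range.mp hk; omega)]
      push_cast
      rw [CharP.cast_eq_zero (ZMod p) p]
      ring
    rw [this, ← Nat.cast_mul, factorial_mul_prod_odd, show 2 * m = p - 1 by omega]
    exact ZMod.wilsons_lemma p
  have hsum : (m.factorial : ZMod p) * (taylor 1 (∑ a ∈ Finset.range p,
      C ((quadraticChar (ZMod p) a : ℤ) : ZMod p) * X ^ a)).coeff m = -1 := by
    rw [taylor_coeff, map_sum, eval_finsetSum, Finset.mul_sum]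
    rw [← sum_eval_of_monic_of_natDegree (F := ZMod p) (f := X ^ m * descPochhammer (ZMod p) m)
      ((monic_X_pow m).mul (monic_descPochhammer _ m))
      (by rw [(monic_X_pow m).natDegree_mul (monic_descPochhammer _ m), natDegree_X_pow,
            descPochhammer_natDegree, ZMod.card]; omega)]
    rw [← sum_range_natCast_zmod]
    refine Finset.sum_congr rfl fun a _ ↦ ?_
    rw [quadraticChar_eq_pow_of_char_ne_two' (by rw [ZMod.ringChar_zmod_n]; omega), ZMod.card,
      show p / 2 = m by omega, C_mul_X_pow_eq_monomial, hasseDeriv_monomial, eval_monomial,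
      eval_mul, eval_pow, eval_X, descPochhammer_eval_eq_descFactorial,
      Nat.descFactorial_eq_factorial_mul_choose]
    push_cast
    ring
  rw [h0, mul_left_comm, hprod] at hsum
  simpa using hsum

lemma prod_range_two_mul_eq {M : Type*} [CommMonoid M] (f : ℕ → M) (m : ℕ) :
    ∏ i ∈ Finset.range (2 * m), f i = ∏ k ∈ Finset.range m, f (2 * k) * f (2 * k + 1) := by
  induction m with
  | zero => simp
  | succ m ih =>
    rw [show 2 * (m + 1) = 2 * m + 1 + 1 by ring, Finset.prod_range_succ, Finset.prod_range_succ,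
      Finset.prod_range_succ, ih, mul_assoc]

lemma IsPrimitiveRoot.sq_prod_pow_sub_pow {R : Type*} [CommRing R] [IsDomain R] {ζ : R} {m : ℕ}
    (hζ : IsPrimitiveRoot ζ (2 * m + 1)) :
    (∏ k ∈ Finset.range m, (ζ ^ (2 * k + 1) - ζ ^ (2 * m + 1 - (2 * k + 1)))) ^ 2
      = (-1) ^ m * (2 * m + 1) := by
  have hζ2 : IsPrimitiveRoot (ζ ^ 2) (2 * m + 1) :=
    hζ.pow_of_coprime 2 (by simp)
  have h := hζ2.prod_one_sub_pow_eq_order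
  rw [prod_range_two_mul_eq, Finset.prod_mul_distrib,
    ← Finset.prod_range_reflect (fun k ↦ 1 - (ζ ^ 2) ^ (2 * k + 1 + 1)),
    ← Finset.prod_mul_distrib] at h
  push_cast at h
  rw [← h, ← Finset.prod_pow, ← Finset.card_range m, ← Finset.prod_const, Finset.card_range,
    ← Finset.prod_mul_distrib]
  refine Finset.prod_congr rfl fun k hk ↦ ?_
  have hk := Finset.mem_range.mp hk
  obtain ⟨n, rfl⟩ : ∃ n, m = k + 1 + n := ⟨m - (k + 1), by omega⟩
  have h1 := hζ.pow_eq_one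
  rw [show 2 * (k + 1 + n) + 1 - (2 * k + 1) = 2 * n + 2 by omega,
    show k + 1 + n - 1 - k = n by omega, ← pow_mul, ← pow_mul]
  have h2 : ζ ^ (2 * k + 1) * ζ ^ (2 * n + 2) = 1 := by rw [← pow_add, ← h1]; congr 1; ring
  have e1 : ζ ^ (2 * (2 * k + 1)) = (ζ ^ (2 * k + 1)) ^ 2 := by rw [← pow_mul]; congr 1; ring
  have e2 : ζ ^ (2 * (2 * n + 1 + 1)) = (ζ ^ (2 * n + 2)) ^ 2 := by rw [← pow_mul]; congr 1; ring
  rw [e1, e2]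
  linear_combination (ζ ^ (2 * k + 1) * ζ ^ (2 * n + 2) - 1) * h2

open Complex in
lemma exp_pow_sub_exp_pow {p a : ℕ} (hp : p ≠ 0) (ha : a ≤ p) :
    exp (2 * Real.pi * I / p) ^ a - exp (2 * Real.pi * I / p) ^ (p - a)
      = 2 * I * Real.sin (2 * Real.pi * a / p) := by
  have hp' : (p : ℂ) ≠ 0 := by exact_mod_cast hp
  rw [← exp_nat_mul, ← exp_nat_mul, Nat.cast_sub ha,
    show ((p : ℂ) - a) * (2 * Real.pi * I / p) = -(a * (2 * Real.pi * I / p)) + 2 * Real.pi * I by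
      field_simp; ring, exp_add, exp_two_pi_mul_I, mul_one,
    show a * (2 * Real.pi * I / p) = (2 * Real.pi * a / p : ℝ) * I by push_cast; ring,
    ← neg_mul, exp_mul_I, exp_mul_I, cos_neg, sin_neg]
  push_cast
  ring

/-- For `p = 4 * j + 3` the product of the `ζ ^ (2 * k + 1) - ζ ^ -(2 * k + 1)` lies on the
positive imaginary axis. -/
lemma exists_pos_prod_exp_eq (j : ℕ) :
    ∃ c : ℝ, 0 < c ∧ ∏ k ∈ Finset.range (2 * j + 1),
      (Complex.exp (2 * Real.pi * Complex.I / (4 * j + 3 : ℕ)) ^ (2 * k + 1)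
        - Complex.exp (2 * Real.pi * Complex.I / (4 * j + 3 : ℕ)) ^ (4 * j + 3 - (2 * k + 1)))
      = Complex.I * c := by
  set s : ℕ → ℝ := fun k ↦ Real.sin (2 * Real.pi * (2 * k + 1 : ℕ) / (4 * j + 3 : ℕ)) with hs
  have hpos : ∀ k ∈ Finset.range (j + 1), 0 < s k := fun k hk ↦ by
    have hk : (k : ℝ) ≤ j := by exact_mod_cast Nat.lt_succ_iff.mp (Finset.mem_range.mp hk)
    apply Real.sin_pos_of_pos_of_lt_pi
    · positivity
    · push_cast
      rw [div_lt_iff₀ (by positivity)]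
      nlinarith [Real.pi_pos]
  have hneg : ∀ k ∈ Finset.range j, 0 < -s (j + 1 + k) := fun k hk ↦ by
    have hk : (k : ℝ) + 1 ≤ j := by exact_mod_cast Finset.mem_range.mp hk
    rw [hs, ← Real.sin_sub_pi]
    apply Real.sin_pos_of_pos_of_lt_pi
    · push_cast
      rw [sub_pos, lt_div_iff₀ (by positivity)]
      nlinarith [Real.pi_pos]
    · push_cast
      rw [sub_lt_iff_lt_add, div_lt_iff₀ (by positivity)]
      nlinarith [Real.pi_pos]
  refine ⟨2 ^ (2 * j + 1) * (∏ k ∈ Finset.range (j + 1), s k) *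
    ∏ k ∈ Finset.range j, -s (j + 1 + k), ?_, ?_⟩
  · have := Finset.prod_pos hpos
    have := Finset.prod_pos hneg
    positivity
  · rw [Finset.prod_congr rfl fun k hk ↦ exp_pow_sub_exp_pow (by omega)
      (by have := Finset.mem_range.mp hk; omega)]
    rw [Finset.prod_mul_distrib, Finset.prod_const, Finset.card_range]
    change _ * ∏ k ∈ Finset.range (2 * j + 1), (s k : ℂ) = _
    rw [show 2 * j + 1 = (j + 1) + j by ring, Finset.prod_range_add, mul_pow, Finset.prod_neg,
      Finset.card_range, show j + 1 + j = 2 * j + 1 by ring, pow_succ Complex.I, pow_mul,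
      Complex.I_sq]
    push_cast
    ring

/-- The sign of the quadratic Gauss sum for primes `p ≡ 3 (mod 4)`. -/
theorem gaussSum_quadraticChar_stdAddChar {p : ℕ} [Fact p.Prime] (hp4 : p % 4 = 3) :
    gaussSum ((quadraticChar (ZMod p)).ringHomComp (Int.castRingHom ℂ)) ZMod.stdAddChar
      = Complex.I * Real.sqrt p := by
  have hp : p.Prime := Fact.out
  obtain ⟨j, rfl⟩ : ∃ j, p = 4 * j + 3 := ⟨p / 4, by omega⟩
  set p := 4 * j + 3 with hpj
  have hchar : ringChar (ZMod p) ≠ 2 := by rw [ZMod.ringChar_zmod_n]; omega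
  set χ := (quadraticChar (ZMod p)).ringHomComp (Int.castRingHom ℂ) with hχ
  set ζ := Complex.exp (2 * Real.pi * Complex.I / p) with hζ
  have hprim : IsPrimitiveRoot ζ p := Complex.isPrimitiveRoot_exp p hp.ne_zero
  obtain ⟨c, hc0, hc⟩ := exists_pos_prod_exp_eq j
  rw [← hζ] at hc
  have hG2 : gaussSum χ ZMod.stdAddChar ^ 2 = -p := by
    rw [gaussSum_sq _ _ (ZMod.isPrimitive_stdAddChar p), ZMod.card, hχ,
      MulChar.ringHomComp_apply, quadraticChar_neg_one hchar, ZMod.card,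
      ZMod.χ₄_nat_three_mod_four hp4]
    · simp
    · exact (MulChar.ringHomComp_ne_one_iff (RingHom.injective_int _)).mpr
        (quadraticChar_ne_one hchar)
    · exact (quadraticChar_isQuadratic _).comp _
  have hP2 : (Complex.I * c) ^ 2 = -(p : ℂ) := by
    have := IsPrimitiveRoot.sq_prod_pow_sub_pow (m := 2 * j + 1) (ζ := ζ)
      (by rw [show 2 * (2 * j + 1) + 1 = p by omega]; exact hprim)
    rw [show 2 * (2 * j + 1) + 1 = 4 * j + 3 by ring, hc] at this
    rw [this, pow_succ, pow_mul, hpj]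
    push_cast
    ring
  have hcp : c = Real.sqrt p := by
    rw [mul_pow, Complex.I_sq, neg_one_mul, neg_inj] at hP2
    have : c ^ 2 = p := by exact_mod_cast hP2
    rw [← this, Real.sqrt_sq hc0.le]
  have hGζ : gaussSum χ ZMod.stdAddChar
      = ∑ a ∈ Finset.range p, (quadraticChar (ZMod p) a : ℂ) * ζ ^ a := by
    rw [gaussSum, ← sum_range_natCast_zmod]
    refine Finset.sum_congr rfl fun a _ ↦ ?_
    congr 1
    have := ZMod.stdAddChar_coe (N := p) a
    rw [Int.cast_natCast] at this
    rw [this, hζ, ← Complex.exp_nat_mul]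
    congr 1
    push_cast
    ring
  obtain ⟨ε, hε⟩ : ∃ ε : ℤ, gaussSum χ ZMod.stdAddChar = ε * (Complex.I * c) := by
    rcases sq_eq_sq_iff_eq_or_eq_neg.mp (hG2.trans hP2.symm) with h | h
    · exact ⟨1, by simpa using h⟩
    · exact ⟨-1, by simpa using h⟩
  have hε2 : ε = 1 ∨ ε = -1 := by
    rw [hε, mul_pow, hP2] at hG2
    have : (ε : ℂ) ^ 2 = 1 := by
      have hp0 : (p : ℂ) ≠ 0 := by exact_mod_cast hp.ne_zero
      apply mul_right_cancel₀ (neg_ne_zero.mpr hp0)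
      rw [hG2, one_mul]
    exact sq_eq_one_iff.mp (by exact_mod_cast this)
  let f : Polynomial ℤ := (∑ a ∈ Finset.range p, Polynomial.C (quadraticChar (ZMod p) a) * .X ^ a)
    - Polynomial.C ε * ∏ k ∈ Finset.range (2 * j + 1), (.X ^ (2 * k + 1) - .X ^ (p - (2 * k + 1)))
  have hf : Polynomial.aeval ζ f = 0 := by
    simp only [f, map_sub, map_mul, map_sum, map_prod, map_pow, Polynomial.aeval_X,
      hpj, hc, eq_intCast, map_intCast]
    rw [← hpj, ← hε, hGζ, sub_self]
  have hdvd := minpoly.isIntegrallyClosed_dvd (hprim.isIntegral hp.pos) hf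
  rw [← Polynomial.cyclotomic_eq_minpoly hprim hp.pos] at hdvd
  have hdvd' := Polynomial.map_dvd (Int.castRingHom (ZMod p)) hdvd
  have hcyc : Polynomial.cyclotomic p (ZMod p) = (Polynomial.X - 1) ^ (p - 1) := by
    have := Polynomial.cyclotomic_mul_prime_pow_eq (ZMod p) (p := p) (m := 1)
      (by simpa using hp.one_lt.ne') (k := 1) one_pos
    simpa using this
  rw [Polynomial.map_cyclotomic, hcyc] at hdvd'
  have h1 : (ε : ZMod p) = 1 := by
    refine eq_one_of_X_sub_one_pow_dvd (p := p) (m := 2 * j + 1) (by omega) (by omega) _ ?_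
    simpa [f, Polynomial.map_sum, Polynomial.map_prod] using hdvd'
  have hε1 : ε = 1 := by
    refine hε2.resolve_right fun h ↦ ?_
    rw [h] at h1
    push_cast at h1
    have : Fact (2 < p) := ⟨by omega⟩
    exact ZMod.neg_one_ne_one h1
  rw [hε, hε1, hcp, Int.cast_one, one_mul]

open Filter Topology in
lemma norm_one_div_rpow_sub_one_div_rpow_le {a : ℝ} (ha : a ∈ Set.Ioo (0 : ℝ) 1)
    {s : ℝ} (hs : s ∈ Set.Ioo (1 : ℝ) 2) {n : ℕ} (hn : n ≠ 0) :
    ‖(((1 / (n + a) ^ s - 1 / (n + 1 - a) ^ s) / 2 : ℝ) : ℂ)‖ ≤ 1 / (n : ℝ) ^ 2 := by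
  have hn1 : (1 : ℝ) ≤ n := by exact_mod_cast Nat.one_le_iff_ne_zero.mpr hn
  obtain ⟨ha0, ha1⟩ := ha
  obtain ⟨hs1, hs2⟩ := hs
  have hder : ∀ t ∈ Set.Icc (n : ℝ) (n + 1),
      HasDerivWithinAt (fun t : ℝ ↦ t ^ (-s)) (-s * t ^ (-s - 1)) (Set.Icc (n : ℝ) (n + 1)) t :=
    fun t ht ↦ (Real.hasDerivAt_rpow_const (Or.inl (by linarith [ht.1]))).hasDerivWithinAt
  have hbd : ∀ t ∈ Set.Icc (n : ℝ) (n + 1), ‖-s * t ^ (-s - 1)‖ ≤ 2 * (1 / (n : ℝ) ^ 2) := by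
    intro t ht
    have ht1 : 1 ≤ t := hn1.trans ht.1
    have h1 : t ^ (-s - 1) ≤ t ^ (-2 : ℝ) := Real.rpow_le_rpow_of_exponent_le ht1 (by linarith)
    have h2 : t ^ (-2 : ℝ) ≤ 1 / (n : ℝ) ^ 2 := by
      rw [Real.rpow_neg (by linarith), ← one_div, Real.rpow_two]
      exact one_div_le_one_div_of_le (by positivity) (by gcongr; exact ht.1)
    rw [norm_mul, norm_neg, Real.norm_of_nonneg (by linarith), Real.norm_of_nonneg (by positivity)]
    have : 0 ≤ t ^ (-s - 1) := by positivity
    nlinarith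
  have hmvt := (convex_Icc (n : ℝ) (n + 1)).norm_image_sub_le_of_norm_hasDerivWithin_le hder hbd
    (x := n + 1 - a) (y := n + a) ⟨by linarith, by linarith⟩ ⟨by linarith, by linarith⟩
  have hd : ‖(n + a : ℝ) - (n + 1 - a)‖ ≤ 1 := by
    rw [Real.norm_eq_abs, abs_le]; constructor <;> linarith
  rw [Complex.norm_real, norm_div, Real.norm_two]
  rw [Real.rpow_neg (by linarith), Real.rpow_neg (by linarith), ← one_div, ← one_div] at hmvt
  have hpos : (0 : ℝ) ≤ 1 / (n : ℝ) ^ 2 := by positivity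
  nlinarith

open Filter Topology in
/-- The partial fraction expansion of the cotangent. -/
lemma tsum_one_div_add_sub_one_div_eq_cot {a : ℝ} (ha : a ∈ Set.Ioo (0 : ℝ) 1)
    (hsum : Summable fun n : ℕ ↦ (1 / (n + a : ℂ) - 1 / (n + 1 - a))) :
    ∑' n : ℕ, (1 / (n + a : ℂ) - 1 / (n + 1 - a)) = Real.pi * Complex.cot (Real.pi * a) := by
  have haZ : (a : ℂ) ∈ Complex.integerComplement := by
    rintro ⟨n, hn⟩
    have hn : (n : ℝ) = a := by exact_mod_cast hn
    have h0 : (0 : ℝ) < n := hn ▸ ha.1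
    have h1 : (n : ℝ) < 1 := hn ▸ ha.2
    have h0' : 0 < n := by exact_mod_cast h0
    have h1' : n < 1 := by exact_mod_cast h1
    omega
  have hlim := tendsto_logDeriv_euler_cot_sub haZ
  refine tendsto_nhds_unique hsum.hasSum.tendsto_sum_nat ?_
  have hpart : ∀ n : ℕ, ∑ i ∈ Finset.range n, (1 / (i + a : ℂ) - 1 / (i + 1 - a))
      = 1 / a + ∑ j ∈ Finset.range n, cotTerm a j - 1 / (n + a) := by
    intro n
    have hne : ∀ k : ℕ, ((k : ℂ) + 1 - a) ≠ 0 := fun k h ↦ by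
      have : ((k : ℝ) + 1 - a) = 0 := by exact_mod_cast h
      linarith [ha.2, (k.cast_nonneg : (0 : ℝ) ≤ k)]
    induction n with
    | zero => simp
    | succ n ih =>
      rw [Finset.sum_range_succ, Finset.sum_range_succ, ih, cotTerm,
        show (a : ℂ) - (n + 1) = -(n + 1 - a) by ring, div_neg]
      push_cast
      rw [show (a : ℂ) + (n + 1) = n + 1 + a by ring]
      ring
  simp_rw [hpart]
  have h0 : Tendsto (fun n : ℕ ↦ 1 / ((n : ℂ) + a)) atTop (𝓝 0) := by
    have : Tendsto (fun n : ℕ ↦ ((1 / ((n : ℝ) + a) : ℝ) : ℂ)) atTop (𝓝 ((0 : ℝ) : ℂ)) := by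
      refine (Complex.continuous_ofReal.tendsto 0).comp ?_
      simp_rw [one_div]
      exact tendsto_inv_atTop_zero.comp
        (tendsto_atTop_add_const_right _ a tendsto_natCast_atTop_atTop)
    simpa using this
  have := (hlim.const_add (1 / (a : ℂ))).sub h0
  simpa using this

open Filter Topology in
lemma hurwitzZetaOdd_one {a : ℝ} (ha : a ∈ Set.Ioo (0 : ℝ) 1) :
    HurwitzZeta.hurwitzZetaOdd a 1 = Real.pi / 2 * Complex.cot (Real.pi * a) := by
  set f : ℝ → ℕ → ℂ := fun s n ↦ (((1 / (n + a) ^ s - 1 / (n + 1 - a) ^ s) / 2 : ℝ) : ℂ) with hf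
  have hpos1 : ∀ n : ℕ, (0 : ℝ) < n + a := fun n ↦ by have := ha.1; positivity
  have hpos2 : ∀ n : ℕ, (0 : ℝ) < n + 1 - a := fun n ↦ by
    linarith [ha.2, (n.cast_nonneg : (0 : ℝ) ≤ n)]
  have hcont : ∀ n, Tendsto (fun s ↦ f s n) (𝓝[>] 1) (𝓝 (f 1 n)) := fun n ↦ by
    apply tendsto_nhdsWithin_of_tendsto_nhds
    apply ContinuousAt.tendsto
    have h1 : ContinuousAt (fun s : ℝ ↦ (n + a) ^ s) 1 :=
      Real.continuousAt_const_rpow (hpos1 n).ne'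
    have h2 : ContinuousAt (fun s : ℝ ↦ (n + 1 - a) ^ s) 1 :=
      Real.continuousAt_const_rpow (hpos2 n).ne'
    refine Complex.continuous_ofReal.continuousAt.comp ?_
    refine ContinuousAt.div_const (ContinuousAt.sub ?_ ?_) 2
    · exact continuousAt_const.div h1 (Real.rpow_pos_of_pos (hpos1 n) _).ne'
    · exact continuousAt_const.div h2 (Real.rpow_pos_of_pos (hpos2 n) _).ne'
  let bound : ℕ → ℝ := fun n ↦ if n = 0 then ‖f 1 0‖ + 1 else 1 / (n : ℝ) ^ 2
  have hbound : Summable bound := by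
    rw [← summable_nat_add_iff 1]
    have := (summable_nat_add_iff 1).mpr (Real.summable_one_div_nat_pow.mpr one_lt_two)
    simpa [bound] using this
  have hev : ∀ᶠ s : ℝ in 𝓝[>] 1, ∀ n, ‖f s n‖ ≤ bound n := by
    have h1 : ∀ᶠ s : ℝ in 𝓝[>] 1, s ∈ Set.Ioo (1 : ℝ) 2 := Ioo_mem_nhdsGT one_lt_two
    have h2 : ∀ᶠ s : ℝ in 𝓝[>] 1, ‖f s 0‖ ≤ ‖f 1 0‖ + 1 :=
      (hcont 0).norm.eventually_le_const (lt_add_one _)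
    filter_upwards [h1, h2] with s hs hs0 n
    by_cases hn : n = 0
    · subst hn; simpa [bound] using hs0
    · simp only [bound, if_neg hn]
      exact norm_one_div_rpow_sub_one_div_rpow_le ha hs hn
  have hdom := tendsto_tsum_of_dominated_convergence hbound hcont hev
  have hs1 : Summable (f 1) := by
    refine .of_norm_bounded hbound fun n ↦ ?_
    exact le_of_tendsto (hcont n).norm (hev.mono fun s hs ↦ hs n)
  have hL : Tendsto (fun s : ℝ ↦ HurwitzZeta.hurwitzZetaOdd a s) (𝓝[>] 1)
      (𝓝 (HurwitzZeta.hurwitzZetaOdd a 1)) := by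
    apply tendsto_nhdsWithin_of_tendsto_nhds
    have h := (HurwitzZeta.differentiable_hurwitzZetaOdd (a : UnitAddCircle)).continuous.comp
      Complex.continuous_ofReal
    simpa [Function.comp_def] using h.tendsto 1
  have hEq : ∀ᶠ s : ℝ in 𝓝[>] 1, ∑' n, f s n = HurwitzZeta.hurwitzZetaOdd a s := by
    filter_upwards [self_mem_nhdsWithin] with s hs
    rw [← (HurwitzZeta.hasSum_nat_hurwitzZetaOdd_of_mem_Icc (Set.Ioo_subset_Icc_self ha)
      (s := s) (by simpa using hs)).tsum_eq]
    refine tsum_congr fun n ↦ ?_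
    simp only [hf]
    push_cast [Complex.ofReal_cpow (hpos1 n).le, Complex.ofReal_cpow (hpos2 n).le]
    rfl
  have hval : ∑' n, f 1 n = Real.pi / 2 * Complex.cot (Real.pi * a) := by
    have hterm : ∀ n : ℕ, (1 / (n + a : ℂ) - 1 / (n + 1 - a)) = 2 * f 1 n := fun n ↦ by
      simp only [hf, Real.rpow_one]
      push_cast
      ring
    have := tsum_one_div_add_sub_one_div_eq_cot ha (by simpa only [hterm] using hs1.mul_left 2)
    simp_rw [hterm] at this
    rw [tsum_mul_left] at this
    linear_combination this / 2
  rw [← hval]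
  exact tendsto_nhds_unique (hL.congr' (hEq.mono fun _ h ↦ h.symm)) hdom

lemma sum_range_mul_pow_mul_sub_one {R : Type*} [CommRing R] (x : R) (n : ℕ) :
    (∑ b ∈ Finset.range n, (b : R) * x ^ b) * (x - 1)
      = n * x ^ n - ∑ b ∈ Finset.range n, x ^ (b + 1) := by
  induction n with
  | zero => simp
  | succ n ih =>
    rw [Finset.sum_range_succ, Finset.sum_range_succ, add_mul, ih]
    push_cast
    ring

/-- The values of the cotangent at rational points, as a finite Fourier transform. -/
lemma cot_pi_mul_val_div {p : ℕ} [Fact p.Prime] {j : ZMod p} (hj : j ≠ 0) :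
    Complex.cot (Real.pi * (j.val / p : ℝ))
      = Complex.I * (1 + 2 / p * ∑ b : ZMod p, (b.val : ℂ) * ZMod.stdAddChar (b * j)) := by
  have hp : p.Prime := Fact.out
  have hp0 : (p : ℂ) ≠ 0 := by exact_mod_cast hp.ne_zero
  set e : ℂ := ZMod.stdAddChar j with he
  have hexp : Complex.exp (2 * Complex.I * (Real.pi * (j.val / p : ℝ))) = e := by
    rw [he, ZMod.stdAddChar_apply, ZMod.toCircle_apply]
    congr 1
    push_cast
    ring
  have he1 : e ≠ 1 := fun h ↦
    hj (ZMod.injective_stdAddChar (h.trans (AddChar.map_zero_eq_one _).symm))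
  have hep : e ^ p = 1 := by
    rw [he, ← AddChar.map_nsmul_eq_pow, nsmul_eq_mul, CharP.cast_eq_zero, zero_mul,
      AddChar.map_zero_eq_one]
  have hsum : ∑ b : ZMod p, (b.val : ℂ) * ZMod.stdAddChar (b * j) = p / (e - 1) := by
    rw [eq_div_iff (sub_ne_zero.mpr he1), ← sum_range_natCast_zmod]
    have : ∀ b ∈ Finset.range p, (((b : ZMod p).val : ℕ) : ℂ) * ZMod.stdAddChar ((b : ZMod p) * j)
        = b * e ^ b := fun b hb ↦ by
      rw [ZMod.val_natCast_of_lt (Finset.mem_range.mp hb), ← nsmul_eq_mul b j,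
        AddChar.map_nsmul_eq_pow]
    rw [Finset.sum_congr rfl this, sum_range_mul_pow_mul_sub_one, hep, mul_one]
    have h0 : (∑ b ∈ Finset.range p, e ^ b) * (e - 1) = 0 := by rw [geom_sum_mul, hep, sub_self]
    have h0' := (mul_eq_zero.mp h0).resolve_right (sub_ne_zero.mpr he1)
    simp_rw [pow_succ, ← Finset.sum_mul, h0']
    simp
  have h2 : 1 - e ≠ 0 := sub_ne_zero.mpr he1.symm
  have h3 : e - 1 ≠ 0 := sub_ne_zero.mpr he1
  rw [hsum, Complex.cot_eq_exp_ratio, hexp, div_eq_iff (mul_ne_zero Complex.I_ne_zero h2)]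
  field_simp
  linear_combination -(1 + e) * (1 - e) * Complex.I_sq

/-- The value `L(1, (·|p))` for a prime `p ≡ 3 (mod 4)`. -/
theorem LFunction_quadraticChar_one {p : ℕ} [Fact p.Prime] (hp4 : p % 4 = 3) :
    DirichletCharacter.LFunction
        ((quadraticChar (ZMod p)).ringHomComp (Int.castRingHom ℂ) : DirichletCharacter ℂ p) 1
      = -Real.pi / (p * Real.sqrt p) * ∑ b : ZMod p, (b.val : ℂ) * quadraticChar (ZMod p) b := by
  have hp : p.Prime := Fact.out
  have hchar : ringChar (ZMod p) ≠ 2 := by rw [ZMod.ringChar_zmod_n]; omega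
  set χ : DirichletCharacter ℂ p := (quadraticChar (ZMod p)).ringHomComp (Int.castRingHom ℂ) with hχ
  have hχa : ∀ a, χ a = quadraticChar (ZMod p) a := fun a ↦ rfl
  have hodd : Function.Odd (χ : ZMod p → ℂ) := fun a ↦ by
    rw [← neg_one_mul, map_mul, hχa (-1), quadraticChar_neg_one hchar, ZMod.card,
      ZMod.χ₄_nat_three_mod_four hp4]
    simp
  have hχ1 : χ ≠ 1 := (MulChar.ringHomComp_ne_one_iff (RingHom.injective_int _)).mpr
    (quadraticChar_ne_one hchar)
  have hχinv : χ⁻¹ = χ := ((quadraticChar_isQuadratic (ZMod p)).comp _).inv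
  have hprim : χ.IsPrimitive := by
    refine ((Nat.dvd_prime hp).mp χ.conductor_dvd_level).resolve_left fun h ↦ hχ1 ?_
    exact DirichletCharacter.eq_one_iff_conductor_eq_one.mpr h
  have hG : ∀ b : ZMod p, ∑ j, χ j * ZMod.stdAddChar (b * j) = χ b * (Complex.I * Real.sqrt p) := by
    intro b
    rw [← gaussSum_quadraticChar_stdAddChar hp4]
    have := gaussSum_mulShift_of_isPrimitive (ZMod.stdAddChar (N := p)) (χ := χ)
      (hprim) b
    rw [hχinv] at this
    simpa only [gaussSum, AddChar.mulShift_apply] using this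
  have hcot : ∀ j : ZMod p, χ j * HurwitzZeta.hurwitzZetaOdd (ZMod.toAddCircle j) 1
      = Real.pi / 2 * Complex.I * (χ j + 2 / p * ∑ b : ZMod p, (b.val : ℂ) *
        (χ j * ZMod.stdAddChar (b * j))) := by
    intro j
    by_cases hj : j = 0
    · simp [hj, χ.map_zero]
    have hv : 0 < j.val := by rw [ZMod.val_pos]; exact hj
    rw [ZMod.toAddCircle_apply, hurwitzZetaOdd_one ⟨by have := hp.pos; positivity,
      (div_lt_one (by exact_mod_cast hp.pos)).mpr (by exact_mod_cast ZMod.val_lt j)⟩,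
      cot_pi_mul_val_div hj]
    simp_rw [mul_left_comm _ (χ j), ← Finset.mul_sum]
    ring
  change ZMod.LFunction χ 1 = _
  rw [ZMod.LFunction_def_odd hodd, Finset.sum_congr rfl fun j _ ↦ hcot j, ← Finset.mul_sum,
    Finset.sum_add_distrib, χ.sum_eq_zero_of_ne_one hχ1, ← Finset.mul_sum, Finset.sum_comm]
  simp_rw [← Finset.mul_sum, hG, ← mul_assoc, ← Finset.sum_mul, hχa]
  have hs : (Real.sqrt p : ℂ) ^ 2 = p := by
    exact_mod_cast Real.sq_sqrt (by positivity : (0 : ℝ) ≤ p)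
  have hs0 : (Real.sqrt p : ℂ) ≠ 0 := by
    exact_mod_cast (Real.sqrt_pos.mpr (by exact_mod_cast hp.pos)).ne'
  rw [Complex.cpow_neg_one, ← hs]
  field_simp
  linear_combination 2 * (∑ x : ZMod p, (x.val : ℂ) * quadraticChar (ZMod p) x) * Complex.I_sq

section QuadraticOrder

open Module

section QuadraticBasis

variable {R A : Type*} [CommRing R] [CommRing A] [Algebra R A] (b : Basis (Fin 2) R A) {s n : R}

lemma leftMulMatrix_of_quadratic_basis (h0 : b 0 = 1) (h1 : b 1 * b 1 = s • b 1 - n • (1 : A))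
    (x y : R) :
    Algebra.leftMulMatrix b (x • 1 + y • b 1) = !![x, -(n * y); y, x + s * y] := by
  have e0 : (x • 1 + y • b 1) * b 0 = x • b 0 + y • b 1 := by rw [h0, mul_one]
  have e1 : (x • 1 + y • b 1) * b 1 = (-(n * y)) • b 0 + (x + s * y) • b 1 := by
    rw [add_mul, smul_mul_assoc, smul_mul_assoc, h1, h0, one_mul]
    module
  ext i j
  rw [Algebra.leftMulMatrix_eq_repr_mul]
  fin_cases j
  · fin_cases i <;> simp [e0]
  · fin_cases i <;> simp [e1]

lemma trace_of_quadratic_basis (h0 : b 0 = 1) (h1 : b 1 * b 1 = s • b 1 - n • (1 : A)) (x y : R) :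
    Algebra.trace R A (x • 1 + y • b 1) = 2 * x + s * y := by
  rw [Algebra.trace_eq_matrix_trace b, leftMulMatrix_of_quadratic_basis b h0 h1,
    Matrix.trace_fin_two]
  simp
  ring

lemma norm_of_quadratic_basis (h0 : b 0 = 1) (h1 : b 1 * b 1 = s • b 1 - n • (1 : A)) (x y : R) :
    Algebra.norm R (x • 1 + y • b 1) = x ^ 2 + s * (x * y) + n * y ^ 2 := by
  rw [Algebra.norm_eq_matrix_det b, leftMulMatrix_of_quadratic_basis b h0 h1, Matrix.det_fin_two]
  simp
  ring

lemma discr_of_quadratic_basis (h0 : b 0 = 1) (h1 : b 1 * b 1 = s • b 1 - n • (1 : A)) :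
    Algebra.discr R b = s ^ 2 - 4 * n := by
  rw [Algebra.discr_def, Matrix.det_fin_two]
  simp only [Algebra.traceMatrix_apply, Algebra.traceForm_apply]
  have t0 := trace_of_quadratic_basis b h0 h1 1 0
  have t1 := trace_of_quadratic_basis b h0 h1 0 1
  have t2 := trace_of_quadratic_basis b h0 h1 (-n) s
  rw [show b 1 * b 1 = (-n) • 1 + s • b 1 by rw [h1]; module, h0, mul_one, one_mul, t2]
  simp only [one_smul, zero_smul, add_zero, zero_add] at t0 t1
  rw [mul_one, t0, t1]
  ring

lemma exists_eq_of_quadratic_basis (h0 : b 0 = 1) (z : A) : ∃ x y : R, z = x • 1 + y • b 1 := by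
  refine ⟨b.repr z 0, b.repr z 1, ?_⟩
  conv_lhs => rw [← b.sum_repr z]
  rw [Fin.sum_univ_two, h0]

end QuadraticBasis

lemma Rat.exists_int_of_prime_mul_sq {p : ℕ} (hp : p.Prime) {y : ℚ} {M : ℤ}
    (h : (p : ℚ) * y ^ 2 = M) : ∃ k : ℤ, y = k := by
  have hp0 : (p : ℚ) ≠ 0 := by exact_mod_cast hp.ne_zero
  have hint : IsIntegral ℤ ((p : ℚ) * y) := by
    refine IsIntegral.of_pow (n := 2) two_pos ?_
    rw [show ((p : ℚ) * y) ^ 2 = ((p * M : ℤ) : ℚ) by push_cast; rw [← h]; ring]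
    exact isIntegral_algebraMap (R := ℤ) (A := ℚ) (x := (p * M : ℤ))
  obtain ⟨w, hw⟩ := IsIntegrallyClosed.isIntegral_iff.mp hint
  have hw' : (w : ℚ) = p * y := hw
  have h2 : w ^ 2 = p * M := by
    have : (w : ℚ) ^ 2 = p * M := by rw [hw', ← h]; ring
    exact_mod_cast this
  obtain ⟨k, rfl⟩ := (Nat.prime_iff_prime_int.mp hp).dvd_of_dvd_pow (Dvd.intro _ h2.symm)
  refine ⟨k, ?_⟩
  push_cast at hw'
  exact (mul_left_cancel₀ hp0 hw').symm

open NumberField in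
/-- The ring of integers of `ℚ(√-p)`, `p = 4 * c - 1`, has basis `1, (1 + √-p) / 2`. -/
lemma exists_basis_ringOfIntegers_sqrt_neg {p c : ℕ} (hp : p.Prime) (hc : p + 1 = 4 * c)
    (K : Type*) [Field K] [NumberField K] (α : K) (hα : α ^ 2 = -(p : K))
    (hgen : Algebra.adjoin ℚ ({α} : Set K) = ⊤) :
    ∃ b : Basis (Fin 2) ℤ (𝓞 K),
      b 0 = 1 ∧ b 1 * b 1 = (1 : ℤ) • b 1 - (c : ℤ) • (1 : 𝓞 K) := by
  have hpc : (p : ℚ) = 4 * c - 1 := by rw [eq_sub_iff_add_eq]; exact_mod_cast hc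
  have hpK : (p : K) = 4 * c - 1 := by rw [eq_sub_iff_add_eq]; exact_mod_cast hc
  set θ : K := (1 + α) / 2 with hθ
  have hθ2 : θ * θ = θ - c := by rw [hθ]; linear_combination (hα - hpK) / 4
  have hli : LinearIndependent ℚ ![(1 : K), θ] := by
    rw [LinearIndependent.pair_iff]
    intro x y h
    rw [Algebra.smul_def, Algebra.smul_def, mul_one] at h
    have hN : (x + y / 2) ^ 2 + p * (y / 2) ^ 2 = 0 := by
      have : algebraMap ℚ K ((x + y / 2) ^ 2 + p * (y / 2) ^ 2) = 0 := by
        simp only [map_add, map_mul, map_pow, map_div₀, map_natCast, map_ofNat]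
        rw [hθ] at h
        linear_combination (algebraMap ℚ K x + algebraMap ℚ K y * ((1 - α) / 2)) * h
          + (algebraMap ℚ K y / 2) ^ 2 * hα
      exact (map_eq_zero _).mp this
    have hp0 : (0 : ℚ) < p := by exact_mod_cast hp.pos
    have hy : y / 2 = 0 := by
      by_contra hy
      have : 0 < p * (y / 2) ^ 2 := by positivity
      nlinarith [sq_nonneg (x + y / 2)]
    rw [hy, zero_pow two_ne_zero, mul_zero, add_zero, add_zero] at hN
    exact ⟨by simpa using hN, by simpa using hy⟩
  have hspan : ⊤ ≤ Submodule.span ℚ (Set.range ![(1 : K), θ]) := by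
    intro z _
    have hz : z ∈ Algebra.adjoin ℚ ({α} : Set K) := hgen ▸ Algebra.mem_top
    rw [Matrix.range_cons, Matrix.range_cons, Matrix.range_empty, Set.union_empty,
      Set.singleton_union, Submodule.mem_span_pair]
    induction hz using Algebra.adjoin_induction with
    | mem x hx =>
      obtain rfl := Set.mem_singleton_iff.mp hx
      exact ⟨-1, 2, by rw [hθ, Algebra.smul_def, Algebra.smul_def]; simp; ring⟩
    | algebraMap r => exact ⟨r, 0, by rw [Algebra.smul_def]; simp⟩
    | add x y _ _ hx hy =>
      obtain ⟨a, b, rfl⟩ := hx trivial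
      obtain ⟨a', b', rfl⟩ := hy trivial
      exact ⟨a + a', b + b', by module⟩
    | mul x y _ _ hx hy =>
      obtain ⟨a, b, rfl⟩ := hx trivial
      obtain ⟨a', b', rfl⟩ := hy trivial
      refine ⟨a * a' - c * (b * b'), a * b' + a' * b + b * b', ?_⟩
      simp only [Algebra.smul_def, map_add, map_sub, map_mul, map_natCast]
      linear_combination -(algebraMap ℚ K b * algebraMap ℚ K b') * hθ2
  set B : Basis (Fin 2) ℚ K := Basis.mk hli hspan with hB
  have hB0 : B 0 = 1 := by simp [hB]
  have hB1 : B 1 = θ := by simp [hB]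
  have hBm : B 1 * B 1 = (1 : ℚ) • B 1 - (c : ℚ) • (1 : K) := by
    rw [hB1, hθ2, Algebra.smul_def, Algebra.smul_def]; simp
  have hθint : IsIntegral ℤ θ := by
    refine ⟨Polynomial.X ^ 2 - Polynomial.X + Polynomial.C (c : ℤ), by monicity!, ?_⟩
    simp only [Polynomial.eval₂_add, Polynomial.eval₂_sub, Polynomial.eval₂_pow,
      Polynomial.eval₂_X, Polynomial.eval₂_C]
    simp [sq, hθ2]
  have key : ∀ z : K, IsIntegral ℤ z → ∃ m k : ℤ, z = m + k * θ := by
    intro z hz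
    obtain ⟨x, y, rfl⟩ := exists_eq_of_quadratic_basis B hB0 z
    obtain ⟨T, hT⟩ := IsIntegrallyClosed.isIntegral_iff.mp (Algebra.isIntegral_trace (L := ℚ) hz)
    obtain ⟨N, hN⟩ := IsIntegrallyClosed.isIntegral_iff.mp (Algebra.isIntegral_norm ℚ hz)
    rw [trace_of_quadratic_basis B hB0 hBm] at hT
    rw [norm_of_quadratic_basis B hB0 hBm] at hN
    simp only [eq_intCast] at hT hN
    obtain ⟨k, rfl⟩ := Rat.exists_int_of_prime_mul_sq hp (y := y) (M := 4 * N - T ^ 2) (by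
      push_cast; rw [hT, hN, hpc]; ring)
    have h4 : 4 * N = T ^ 2 - k ^ 2 + 4 * c * k ^ 2 := by
      have : (4 * N : ℚ) = T ^ 2 - k ^ 2 + 4 * c * k ^ 2 := by rw [hT, hN]; ring
      exact_mod_cast this
    have heven : Even (T - k) := by
      have : Even (T ^ 2 - k ^ 2) := ⟨2 * N - 2 * c * k ^ 2, by linear_combination -h4⟩
      rw [Int.even_sub, Int.even_pow' two_ne_zero, Int.even_pow' two_ne_zero] at this
      rwa [Int.even_sub]
    obtain ⟨m, hm⟩ := heven
    refine ⟨m, k, ?_⟩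
    have hx : x = m := by
      have : (T - k : ℚ) = m + m := by exact_mod_cast hm
      linarith
    rw [hx, hB1, Algebra.smul_def, Algebra.smul_def]
    simp
  obtain ⟨Θ, hΘ⟩ : ∃ Θ : 𝓞 K, algebraMap (𝓞 K) K Θ = θ := ⟨⟨θ, hθint⟩, rfl⟩
  have hli' : LinearIndependent ℤ ![(1 : 𝓞 K), Θ] := by
    rw [LinearIndependent.pair_iff] at hli ⊢
    intro x y h
    have h' := congrArg (algebraMap (𝓞 K) K) h
    rw [zsmul_eq_mul, zsmul_eq_mul, map_add, map_mul, map_mul, hΘ, map_intCast, map_intCast,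
      map_one, map_zero] at h'
    have := hli x y (by simpa [Algebra.smul_def] using h')
    exact_mod_cast this
  have hspan' : ⊤ ≤ Submodule.span ℤ (Set.range ![(1 : 𝓞 K), Θ]) := by
    intro z _
    rw [Matrix.range_cons, Matrix.range_cons, Matrix.range_empty, Set.union_empty,
      Set.singleton_union, Submodule.mem_span_pair]
    obtain ⟨m, k, h⟩ := key z z.isIntegral_coe
    refine ⟨m, k, FaithfulSMul.algebraMap_injective (𝓞 K) K ?_⟩
    rw [show algebraMap (𝓞 K) K z = m + k * θ from h, zsmul_eq_mul, zsmul_eq_mul,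
      map_add, map_mul, map_mul, hΘ, map_intCast, map_intCast,
      map_one, mul_one]
  refine ⟨Basis.mk hli' hspan', by simp, FaithfulSMul.algebraMap_injective (𝓞 K) K ?_⟩
  simp only [Basis.mk_apply, Matrix.cons_val_one, Matrix.cons_val_zero, one_smul, zsmul_eq_mul,
    map_mul, map_sub, hΘ, hθ2, mul_one, Int.cast_natCast, map_natCast]

namespace Ideal

section Count

variable {S : Type*} [CommRing S] [IsDedekindDomain S] [Module.Free ℤ S]

lemma eq_of_dvd_of_absNorm_eq {I J : Ideal S} (h : I ∣ J) (hN : absNorm I = absNorm J)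
    (h0 : absNorm J ≠ 0) : I = J := by
  obtain ⟨C, rfl⟩ := h
  rw [map_mul] at hN h0
  have hC : absNorm C = 1 :=
    Nat.eq_of_mul_eq_mul_left (Nat.pos_of_ne_zero (left_ne_zero_of_mul h0)) (by rw [← hN, mul_one])
  rw [absNorm_eq_one_iff.mp hC, mul_top]

lemma isCoprime_of_coprime_absNorm {I J : Ideal S} (h : (absNorm I).Coprime (absNorm J)) :
    IsCoprime I J := by
  rw [isCoprime_iff_exists]
  obtain ⟨u, v, huv⟩ := Nat.isCoprime_iff_coprime.mpr h
  refine ⟨u * absNorm I, I.mul_mem_left _ I.absNorm_mem, v * absNorm J,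
    J.mul_mem_left _ J.absNorm_mem, ?_⟩
  exact_mod_cast congrArg (Int.cast : ℤ → S) huv

lemma card_absNorm_eq_mul [Module.Finite ℤ S] {m n : ℕ} (h : m.Coprime n)
    (hm : m ≠ 0) (hn : n ≠ 0) :
    Nat.card {I : Ideal S // absNorm I = m * n} =
      Nat.card {I : Ideal S // absNorm I = m} * Nat.card {I : Ideal S // absNorm I = n} := by
  rw [← Nat.card_prod]
  symm
  refine Nat.card_congr (Equiv.ofBijective
    (fun x ↦ ⟨x.1.1 * x.2.1, by rw [map_mul, x.1.2, x.2.2]⟩) ⟨?_, ?_⟩)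
  · have aux : ∀ I J I' J' : Ideal S, absNorm I = m → absNorm J' = n → I * J = I' * J' →
        absNorm I' = m → I = I' := by
      intro I J I' J' hI hJ' heq hI'
      refine eq_of_dvd_of_absNorm_eq ?_ (hI.trans hI'.symm) (by rwa [hI'])
      exact (isCoprime_of_coprime_absNorm (by rwa [hI, hJ'])).dvd_of_dvd_mul_right
        (Dvd.intro _ heq)
    rintro ⟨⟨I, hI⟩, J, hJ⟩ ⟨⟨I', hI'⟩, J', hJ'⟩ heq
    have heq' : I * J = I' * J' := congrArg Subtype.val heq
    obtain rfl := aux I J I' J' hI hJ' heq' hI'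
    have hI0 : I ≠ 0 := by
      rintro rfl
      exact hm (by rw [← hI, map_zero])
    obtain rfl := mul_left_cancel₀ hI0 heq'
    rfl
  · rintro ⟨L, hL⟩
    have hdvd : L ∣ span {(m : S)} * span {(n : S)} := by
      rw [span_singleton_mul_span_singleton, dvd_span_singleton, ← Nat.cast_mul, ← hL]
      exact L.absNorm_mem
    obtain ⟨I, J, hI, hJ, rfl⟩ := exists_dvd_and_dvd_of_dvd_mul hdvd
    rw [map_mul] at hL
    have hI' := map_dvd absNorm hI
    have hJ' := map_dvd absNorm hJ
    rw [absNorm_span_natCast] at hI' hJ'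
    have hIm : absNorm I ∣ m :=
      (Nat.Coprime.of_dvd_left hI' (h.pow_left _)).dvd_of_dvd_mul_right (Dvd.intro _ hL)
    have hJn : absNorm J ∣ n :=
      (Nat.Coprime.of_dvd_left hJ' (h.symm.pow_left _)).dvd_of_dvd_mul_left (Dvd.intro_left _ hL)
    have hIm' : absNorm I = m := by
      refine Nat.dvd_antisymm hIm ((Nat.mul_dvd_mul_iff_right (Nat.pos_of_ne_zero hn)).mp ?_)
      rw [← hL]
      exact mul_dvd_mul_left _ hJn
    refine ⟨⟨⟨I, hIm'⟩, J, ?_⟩, rfl⟩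
    rw [hIm'] at hL
    exact Nat.eq_of_mul_eq_mul_left (Nat.pos_of_ne_zero hm) hL

lemma card_absNorm_eq_mul_and_dvd {P : Ideal S} (hP : absNorm P ≠ 0) (n : ℕ) :
    Nat.card {I : Ideal S // absNorm I = absNorm P * n ∧ P ∣ I} =
      Nat.card {I : Ideal S // absNorm I = n} := by
  have hP0 : P ≠ 0 := by
    rintro rfl
    exact hP (map_zero _)
  symm
  refine Nat.card_congr (Equiv.ofBijective
    (fun x ↦ ⟨P * x.1, by rw [map_mul, x.2], dvd_mul_right _ _⟩) ⟨?_, ?_⟩)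
  · rintro ⟨I, _⟩ ⟨J, _⟩ h
    exact Subtype.ext (mul_left_cancel₀ hP0 (congrArg Subtype.val h))
  · rintro ⟨_, hI, J, rfl⟩
    refine ⟨⟨J, ?_⟩, rfl⟩
    rw [map_mul] at hI
    exact Nat.eq_of_mul_eq_mul_left (Nat.pos_of_ne_zero hP) hI

lemma card_absNorm_eq_one : Nat.card {I : Ideal S // absNorm I = 1} = 1 := by
  simp [absNorm_eq_one_iff]

variable [Module.Finite ℤ S] {q : ℕ}

lemma exists_isPrime_dvd_of_absNorm_eq_pow_succ [CharZero S] (hrank : finrank ℤ S = 2)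
    (hq : q.Prime) {I : Ideal S} {k : ℕ} (hI : absNorm I = q ^ (k + 1)) :
    ∃ P : Ideal S, P.IsPrime ∧ P ∣ I ∧ P ∣ span {(q : S)} ∧
      (absNorm P = q ∨ P = span {(q : S)}) := by
  obtain ⟨P, hPm, hPq, hPI⟩ := exists_isMaximal_dvd_of_dvd_absNorm' hq I
    (hI ▸ dvd_pow_self q k.succ_ne_zero)
  have hqP : P ∣ span {(q : S)} := by
    rw [dvd_span_singleton]
    have : (q : ℤ) ∈ P.under ℤ := hPq ▸ mem_span_singleton_self _
    simpa [mem_comap] using this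
  refine ⟨P, hPm.isPrime, hPI, hqP, ?_⟩
  have hN := map_dvd absNorm hqP
  have hN2 : absNorm (span {(q : S)}) = q ^ 2 := by rw [absNorm_span_natCast, hrank]
  rw [hN2, Nat.dvd_prime_pow hq] at hN
  obtain ⟨i, hi, hPi⟩ := hN
  interval_cases i
  · rw [pow_zero, absNorm_eq_one_iff] at hPi
    exact absurd hPi hPm.ne_top
  · exact Or.inl (by simpa using hPi)
  · exact Or.inr (eq_of_dvd_of_absNorm_eq hqP (hPi.trans hN2.symm)
      (hN2 ▸ pow_ne_zero _ hq.ne_zero))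

lemma card_absNorm_eq_pow_of_card_eq_zero [CharZero S] (hrank : finrank ℤ S = 2)
    (hq : q.Prime) (h : Nat.card {I : Ideal S // absNorm I = q} = 0) (k : ℕ) :
    (Nat.card {I : Ideal S // absNorm I = q ^ k} : ℤ) = ∑ i ∈ Finset.range (k + 1), (-1) ^ i := by
  have hN2 : absNorm (span {(q : S)}) = q ^ 2 := by rw [absNorm_span_natCast, hrank]
  induction k using Nat.twoStepInduction with
  | zero => simp
  | one => simp [h, Finset.sum_range_succ]
  | more k ih _ =>
    have hstep := card_absNorm_eq_mul_and_dvd (P := span {(q : S)})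
      (by rw [hN2]; exact pow_ne_zero _ hq.ne_zero) (q ^ k)
    rw [hN2, ← pow_add, add_comm 2 k] at hstep
    rw [Finset.sum_range_succ, Finset.sum_range_succ, ← ih, ← hstep]
    have : ∀ I : Ideal S, absNorm I = q ^ (k + 2) → span {(q : S)} ∣ I := by
      intro I hI
      obtain ⟨P, -, hPI, -, hP | rfl⟩ := exists_isPrime_dvd_of_absNorm_eq_pow_succ hrank hq hI
      · have : Finite {I : Ideal S // absNorm I = q} := finite_setOfPred_absNorm_eq q
        have : IsEmpty {I : Ideal S // absNorm I = q} := by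
          exact (Nat.card_eq_zero.mp h).resolve_right (not_infinite_iff_finite.mpr this)
        exact this.elim ⟨P, hP⟩
      · exact hPI
    rw [Nat.card_congr (Equiv.subtypeEquivRight (q := fun I : Ideal S ↦ absNorm I = q ^ (k + 2))
      fun I ↦ and_iff_left_of_imp (this I))]
    ring

lemma card_absNorm_eq_pow_of_card_eq_one [CharZero S] (hrank : finrank ℤ S = 2)
    (hq : q.Prime) (h : Nat.card {I : Ideal S // absNorm I = q} = 1) (k : ℕ) :
    Nat.card {I : Ideal S // absNorm I = q ^ k} = 1 := by
  have hN2 : absNorm (span {(q : S)}) = q ^ 2 := by rw [absNorm_span_natCast, hrank]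
  obtain ⟨hsub, ⟨P, hP⟩⟩ := Nat.card_eq_one_iff_unique.mp h
  have hPq : P ^ 2 = span {(q : S)} := by
    have : P ∣ span {(q : S)} := by rw [dvd_span_singleton, ← hP]; exact P.absNorm_mem
    obtain ⟨Q, hQ⟩ := this
    have hQN : absNorm Q = q := by
      rw [hQ, map_mul, hP, sq] at hN2
      exact Nat.eq_of_mul_eq_mul_left hq.pos hN2
    have : Q = P := congrArg Subtype.val (hsub.elim ⟨Q, hQN⟩ ⟨P, hP⟩)
    rw [hQ, this, sq]
  have hPp : P.IsPrime := isPrime_of_irreducible_absNorm (hP ▸ hq)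
  induction k with
  | zero => simp
  | succ k ih =>
    have hdvd : ∀ I : Ideal S, absNorm I = q ^ (k + 1) → P ∣ I := by
      intro I hI
      obtain ⟨Q, hQp, hQI, hQq, hQ | rfl⟩ := exists_isPrime_dvd_of_absNorm_eq_pow_succ hrank hq hI
      · have : Q = P := congrArg Subtype.val (hsub.elim ⟨Q, hQ⟩ ⟨P, hP⟩)
        rwa [← this]
      · exact (Dvd.intro_left _ (by rw [← hPq, pow_succ, pow_one])).trans hQI
    have hstep := card_absNorm_eq_mul_and_dvd (P := P) (hP ▸ hq.ne_zero) (q ^ k)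
    rw [hP, ← pow_succ', ih] at hstep
    exact (Nat.card_congr
      (Equiv.subtypeEquivRight fun I ↦ (and_iff_left_of_imp (hdvd I)).symm)).trans hstep

lemma card_absNorm_eq_pow_of_card_eq_two [CharZero S] (hrank : finrank ℤ S = 2)
    (hq : q.Prime) (h : Nat.card {I : Ideal S // absNorm I = q} = 2) (k : ℕ) :
    Nat.card {I : Ideal S // absNorm I = q ^ k} = k + 1 := by
  have hN2 : absNorm (span {(q : S)}) = q ^ 2 := by rw [absNorm_span_natCast, hrank]
  obtain ⟨⟨P, hP⟩, ⟨Q, hQ⟩, hne, huniv⟩ := Nat.card_eq_two_iff.mp h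
  have hPQ : P ≠ Q := fun h ↦ hne (Subtype.ext h)
  have hor : ∀ R : Ideal S, absNorm R = q → R = P ∨ R = Q := by
    intro R hR
    have : (⟨R, hR⟩ : {I : Ideal S // absNorm I = q}) ∈
        ({⟨P, hP⟩, ⟨Q, hQ⟩} : Set {I : Ideal S // absNorm I = q}) := huniv ▸ Set.mem_univ _
    simpa using this
  have hPp : Prime P := UniqueFactorizationMonoid.irreducible_iff_prime.mp
    (irreducible_of_irreducible_absNorm (hP ▸ hq))
  have hQp : Prime Q := UniqueFactorizationMonoid.irreducible_iff_prime.mp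
    (irreducible_of_irreducible_absNorm (hQ ▸ hq))
  have hPnQ : ¬ P ∣ Q := fun hd ↦ hPQ (eq_of_dvd_of_absNorm_eq hd (hP.trans hQ.symm)
    (hQ ▸ hq.ne_zero))
  have hPqd : P ∣ span {(q : S)} := by rw [dvd_span_singleton, ← hP]; exact P.absNorm_mem
  have hfin (k : ℕ) : Finite {I : Ideal S // absNorm I = q ^ k} := finite_setOfPred_absNorm_eq _
  have hQpow : ∀ (k : ℕ) (I : Ideal S), absNorm I = q ^ k → ¬ P ∣ I → I = Q ^ k := by
    intro k
    induction k with
    | zero =>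
      intro I hI _
      rw [pow_zero, absNorm_eq_one_iff] at hI
      rw [hI, pow_zero, one_eq_top]
    | succ k ih =>
      intro I hI hPI
      obtain ⟨R, hRp, hRI, hRq, hR | rfl⟩ :=
        exists_isPrime_dvd_of_absNorm_eq_pow_succ hrank hq hI
      · obtain rfl | rfl := hor R hR
        · exact absurd hRI hPI
        · obtain ⟨J, rfl⟩ := hRI
          rw [ih J ?_ fun h ↦ hPI (h.mul_left _), pow_succ']
          rw [map_mul, hR, pow_succ'] at hI
          exact Nat.eq_of_mul_eq_mul_left hq.pos hI
      · exact absurd (hPqd.trans hRI) hPI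
  induction k with
  | zero => simp
  | succ k ih =>
    classical
    have hstep := card_absNorm_eq_mul_and_dvd (P := P) (hP ▸ hq.ne_zero) (q ^ k)
    rw [hP, ← pow_succ', ih] at hstep
    have e := Equiv.sumCompl (fun I : {I : Ideal S // absNorm I = q ^ (k + 1)} ↦ P ∣ I.1)
    rw [← Nat.card_congr e, Nat.card_sum,
      Nat.card_congr (Equiv.subtypeSubtypeEquivSubtypeInter _ (fun I : Ideal S ↦ P ∣ I)), hstep]
    congr 1
    rw [Nat.card_eq_one_iff_unique]
    refine ⟨⟨?_⟩, ⟨⟨Q ^ (k + 1), by rw [map_pow, hQ]⟩, fun h ↦ hPnQ (hPp.dvd_of_dvd_pow h)⟩⟩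
    rintro ⟨⟨I, hI⟩, hI'⟩ ⟨⟨J, hJ⟩, hJ'⟩
    simp only [Subtype.mk.injEq]
    rw [hQpow _ I hI hI', hQpow _ J hJ hJ']

/-- The number of ideals of norm `q ^ k` in a quadratic order is determined by the number of
ideals of norm `q`. -/
lemma card_absNorm_eq_pow [CharZero S] (hrank : finrank ℤ S = 2) (hq : q.Prime) {ε : ℤ}
    (hε : ε = -1 ∨ ε = 0 ∨ ε = 1) (h : (Nat.card {I : Ideal S // absNorm I = q} : ℤ) = 1 + ε)
    (k : ℕ) :
    (Nat.card {I : Ideal S // absNorm I = q ^ k} : ℤ) = ∑ i ∈ Finset.range (k + 1), ε ^ i := by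
  obtain rfl | rfl | rfl := hε
  · exact card_absNorm_eq_pow_of_card_eq_zero hrank hq (by simpa using h) k
  · rw [card_absNorm_eq_pow_of_card_eq_one hrank hq (by exact_mod_cast h) k,
      Finset.sum_range_succ']
    simp
  · rw [card_absNorm_eq_pow_of_card_eq_two hrank hq (by exact_mod_cast h) k]
    simp

end Count

end Ideal

section NormPrime

variable {S : Type*} [CommRing S] (b : Basis (Fin 2) ℤ S) {s n : ℤ}

lemma repr_zero_of_quadratic_basis (h0 : b 0 = 1) (x y : ℤ) :
    b.repr (x • 1 + y • b 1) 0 = x := by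
  rw [← h0, map_add, map_smul, map_smul, Basis.repr_self, Basis.repr_self]
  simp

lemma repr_one_of_quadratic_basis (h0 : b 0 = 1) (x y : ℤ) :
    b.repr (x • 1 + y • b 1) 1 = y := by
  rw [← h0, map_add, map_smul, map_smul, Basis.repr_self, Basis.repr_self]
  simp

/-- The ring homomorphism from a quadratic order to a commutative ring `R` given by a root in `R`
of the minimal polynomial of the generator. -/
noncomputable def quadraticBasisLift (h0 : b 0 = 1)
    (h1 : b 1 * b 1 = s • b 1 - n • (1 : S)) {R : Type*} [CommRing R] (x : R)
    (hx : x * x = s * x - n) : S →+* R where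
  toFun z := b.repr z 0 + b.repr z 1 * x
  map_one' := by simp [← h0]
  map_zero' := by simp
  map_add' z w := by simp; ring
  map_mul' z w := by
    obtain ⟨z0, z1, rfl⟩ := exists_eq_of_quadratic_basis b h0 z
    obtain ⟨w0, w1, rfl⟩ := exists_eq_of_quadratic_basis b h0 w
    have hmul : (z0 • (1 : S) + z1 • b 1) * (w0 • 1 + w1 • b 1) =
        (z0 * w0 - n * (z1 * w1)) • (1 : S) + (z0 * w1 + z1 * w0 + s * (z1 * w1)) • b 1 := by
      simp only [zsmul_eq_mul] at h1 ⊢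
      push_cast
      linear_combination (z1 * w1 : S) * h1
    simp only [hmul, repr_zero_of_quadratic_basis b h0, repr_one_of_quadratic_basis b h0]
    push_cast
    linear_combination -(z1 * w1 : R) * hx

lemma quadraticBasisLift_apply (h0 : b 0 = 1) (h1 : b 1 * b 1 = s • b 1 - n • (1 : S))
    {R : Type*} [CommRing R] (x : R) (hx : x * x = s * x - n) (y z : ℤ) :
    quadraticBasisLift b h0 h1 x hx (y • 1 + z • b 1) = y + z * x := by
  simp only [quadraticBasisLift, RingHom.coe_mk, MonoidHom.coe_mk, OneHom.coe_mk,
    repr_zero_of_quadratic_basis b h0, repr_one_of_quadratic_basis b h0]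

/-- Ideals of prime norm `q` in a quadratic order correspond to roots modulo `q` of the minimal
polynomial of the generator. -/
lemma card_absNorm_eq_prime_of_quadratic_basis [IsDedekindDomain S] [Module.Free ℤ S]
    (h0 : b 0 = 1) (h1 : b 1 * b 1 = s • b 1 - n • (1 : S)) {q : ℕ} (hq : q.Prime) :
    Nat.card {I : Ideal S // Ideal.absNorm I = q} =
      Nat.card {x : ZMod q // x * x = s * x - n} := by
  have : Fact q.Prime := ⟨hq⟩
  symm
  have hsurj : ∀ f : S →+* ZMod q, Function.Surjective f := ZMod.ringHom_surjective
  have hnorm : ∀ f : S →+* ZMod q, Ideal.absNorm (RingHom.ker f) = q := by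
    intro f
    rw [Ideal.absNorm_apply, Submodule.cardQuot_apply,
      Nat.card_congr (RingHom.quotientKerEquivOfSurjective (hsurj f)).toEquiv, Nat.card_zmod]
  refine Nat.card_congr (Equiv.ofBijective
    (fun x ↦ ⟨RingHom.ker (quadraticBasisLift b h0 h1 x.1 x.2), hnorm _⟩) ⟨?_, ?_⟩)
  · rintro ⟨x, hx⟩ ⟨y, hy⟩ h
    have hker : RingHom.ker (quadraticBasisLift b h0 h1 x hx) =
        RingHom.ker (quadraticBasisLift b h0 h1 y hy) := congrArg Subtype.val h
    have hmem : (-(x.val : ℤ)) • (1 : S) + (1 : ℤ) • b 1 ∈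
        RingHom.ker (quadraticBasisLift b h0 h1 x hx) := by
      rw [RingHom.mem_ker, quadraticBasisLift_apply]
      simp
    rw [hker, RingHom.mem_ker, quadraticBasisLift_apply] at hmem
    refine Subtype.ext ?_
    simp only [Int.cast_neg, Int.cast_natCast, ZMod.natCast_zmod_val, Int.cast_one,
      one_mul] at hmem
    linear_combination -hmem
  · rintro ⟨I, hI⟩
    have hcard : Nat.card (S ⧸ I) = q := by
      rw [← hI, Ideal.absNorm_apply, Submodule.cardQuot_apply]
    have : Finite (S ⧸ I) := Nat.finite_of_card_ne_zero (hcard ▸ hq.ne_zero)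
    have := Fintype.ofFinite (S ⧸ I)
    have e := (ZMod.ringEquivOfPrime (S ⧸ I) hq (by rw [← Nat.card_eq_fintype_card, hcard])).symm
    set f : S →+* ZMod q := (e : S ⧸ I →+* ZMod q).comp (Ideal.Quotient.mk I) with hf
    have hfI : RingHom.ker f = I := by
      ext z
      simp [hf, RingHom.mem_ker, Ideal.Quotient.eq_zero_iff_mem]
    have hx : f (b 1) * f (b 1) = s * f (b 1) - n := by
      rw [← map_mul, h1, zsmul_eq_mul, zsmul_eq_mul, mul_one]
      simp
    refine ⟨⟨f (b 1), hx⟩, Subtype.ext ?_⟩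
    have : quadraticBasisLift b h0 h1 (f (b 1)) hx = f := by
      ext z
      obtain ⟨z0, z1, rfl⟩ := exists_eq_of_quadratic_basis b h0 z
      rw [quadraticBasisLift_apply]
      simp
    simp only [this, hfI]

end NormPrime

lemma legendreSym_neg_natCast_of_mod_four_eq_three {p q : ℕ} [Fact p.Prime] [Fact q.Prime]
    (hp4 : p % 4 = 3) (hq : q ≠ 2) : legendreSym q (-p) = legendreSym p q := by
  have hp2 : p ≠ 2 := by omega
  rw [legendreSym.at_neg hq]
  have hq2 := (Nat.Prime.eq_two_or_odd (Fact.out : q.Prime)).resolve_left hq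
  obtain h | h : q % 4 = 1 ∨ q % 4 = 3 := by omega
  · rw [ZMod.χ₄_nat_one_mod_four h, one_mul, legendreSym.quadratic_reciprocity_one_mod_four h hp2]
  · rw [ZMod.χ₄_nat_three_mod_four h, legendreSym.quadratic_reciprocity_three_mod_four hp4 h,
      neg_one_mul, neg_neg]

lemma card_sq_eq_sub_zero_zmod_two :
    (Nat.card {x : ZMod 2 // x * x = (1 : ℤ) * x - 0} : ℤ) = 1 + 1 := by
  rw [Nat.card_eq_fintype_card]
  decide

lemma card_sq_eq_sub_one_zmod_two :
    (Nat.card {x : ZMod 2 // x * x = (1 : ℤ) * x - 1} : ℤ) = 1 + -1 := by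
  rw [Nat.card_eq_fintype_card]
  decide

lemma card_sq_eq_sub_zmod {p q c : ℕ} [Fact p.Prime] [Fact q.Prime] (hc : p + 1 = 4 * c) :
    (Nat.card {x : ZMod q // x * x = (1 : ℤ) * x - (c : ℤ)} : ℤ) = 1 + legendreSym p q := by
  have hp4 : p % 4 = 3 := by omega
  by_cases hq : q = 2
  · subst hq
    rw [Nat.cast_ofNat, legendreSym.at_two (by omega), ZMod.χ₈_nat_eq_if_mod_eight,
      if_neg (by omega)]
    simp only [Int.cast_natCast]
    obtain h | h := Nat.even_or_odd c
    · have h0 : (c : ZMod 2) = 0 := (ZMod.natCast_eq_zero_iff_even).mpr h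
      obtain ⟨d, rfl⟩ := h
      rw [if_pos (by omega), h0]
      exact card_sq_eq_sub_zero_zmod_two
    · have h0 : (c : ZMod 2) = 1 := (ZMod.natCast_eq_one_iff_odd).mpr h
      obtain ⟨d, rfl⟩ := h
      rw [if_neg (by omega), h0]
      exact card_sq_eq_sub_one_zmod_two
  · rw [← legendreSym_neg_natCast_of_mod_four_eq_three hp4 hq, add_comm 1,
      ← legendreSym.card_sqrts q hq, Nat.cast_inj, Set.toFinset_card, ← Nat.card_eq_fintype_card]
    have h2 : (2 : ZMod q) ≠ 0 := by
      intro h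
      have := (ZMod.natCast_eq_zero_iff 2 q).mp (by exact_mod_cast h)
      exact hq ((Nat.prime_dvd_prime_iff_eq Fact.out Nat.prime_two).mp this)
    have hcq : (p : ZMod q) + 1 = 4 * c := by exact_mod_cast congrArg (Nat.cast : ℕ → ZMod q) hc
    refine Nat.card_congr ⟨fun x ↦ ⟨2 * x.1 - 1, ?_⟩, fun y ↦ ⟨(y.1 + 1) / 2, ?_⟩, ?_, ?_⟩
    · have := x.2
      simp only [Set.mem_ofPred_eq, Int.cast_neg, Int.cast_natCast, Int.cast_one, one_mul] at this ⊢
      linear_combination 4 * this + hcq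
    · have := y.2
      simp only [Set.mem_ofPred_eq, Int.cast_neg, Int.cast_natCast, Int.cast_one, one_mul] at this ⊢
      field_simp
      linear_combination this - hcq
    · intro x
      ext
      simp only
      field_simp
      ring
    · intro y
      ext
      simp only
      field_simp
      ring

end QuadraticOrder

section ZetaFactorization

open Module

lemma Ideal.card_absNorm_eq_sum_divisors {S : Type*} [CommRing S] [IsDedekindDomain S]
    [CharZero S] [Module.Free ℤ S] [Module.Finite ℤ S] (hrank : finrank ℤ S = 2)
    (χ : ℕ →*₀ ℤ) (hχ : ∀ q : ℕ, q.Prime → χ q = -1 ∨ χ q = 0 ∨ χ q = 1)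
    (h : ∀ q : ℕ, q.Prime → (Nat.card {I : Ideal S // absNorm I = q} : ℤ) = 1 + χ q)
    {n : ℕ} (hn : n ≠ 0) :
    (Nat.card {I : Ideal S // absNorm I = n} : ℤ) = ∑ d ∈ n.divisors, χ d := by
  set A : ArithmeticFunction ℤ :=
    ⟨fun n ↦ if n = 0 then 0 else (Nat.card {I : Ideal S // absNorm I = n} : ℤ), by simp⟩ with hA
  have hA' : ∀ n : ℕ, n ≠ 0 → A n = (Nat.card {I : Ideal S // absNorm I = n} : ℤ) := by
    intro n hn
    simp [hA, hn]
  set X : ArithmeticFunction ℤ := ⟨χ, map_zero χ⟩ with hX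
  have hX' : ∀ n, X n = χ n := fun _ ↦ rfl
  have hAm : A.IsMultiplicative := by
    refine ArithmeticFunction.IsMultiplicative.iff_ne_zero.mpr ⟨?_, ?_⟩
    · rw [hA' 1 one_ne_zero, card_absNorm_eq_one, Nat.cast_one]
    · intro m n hm hn hmn
      rw [hA' _ (mul_ne_zero hm hn), hA' m hm, hA' n hn, card_absNorm_eq_mul hmn hm hn,
        Nat.cast_mul]
  have hXm : X.IsMultiplicative :=
    ⟨by rw [hX', map_one], fun {m n} _ ↦ by rw [hX', hX', hX', map_mul]⟩
  have key : A = ↑ArithmeticFunction.zeta * X := by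
    rw [ArithmeticFunction.IsMultiplicative.eq_iff_eq_on_prime_powers _ hAm _
      (ArithmeticFunction.isMultiplicative_zeta.natCast.mul hXm)]
    intro q k hq
    rw [hA' _ (pow_ne_zero _ hq.ne_zero), card_absNorm_eq_pow hrank hq (hχ q hq) (h q hq),
      ArithmeticFunction.coe_zeta_mul_apply, Nat.sum_divisors_prime_pow hq]
    simp only [hX', map_pow]
  rw [← hA' n hn, key, ArithmeticFunction.coe_zeta_mul_apply]
  simp only [hX']

lemma card_absNorm_eq_sum_quadraticChar {p c : ℕ} [Fact p.Prime] (hc : p + 1 = 4 * c)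
    {S : Type*} [CommRing S] [IsDedekindDomain S] [CharZero S] [Module.Free ℤ S]
    (b : Basis (Fin 2) ℤ S)
    (h0 : b 0 = 1) (h1 : b 1 * b 1 = (1 : ℤ) • b 1 - (c : ℤ) • (1 : S)) {n : ℕ} (hn : n ≠ 0) :
    (Nat.card {I : Ideal S // Ideal.absNorm I = n} : ℤ) =
      ∑ d ∈ n.divisors, quadraticChar (ZMod p) d := by
  have : Module.Finite ℤ S := Module.Finite.of_basis b
  have hval (q : ℕ) : quadraticChar (ZMod p) q = legendreSym p q := by
    rw [legendreSym, Int.cast_natCast]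
  refine Ideal.card_absNorm_eq_sum_divisors (by rw [finrank_eq_card_basis b, Fintype.card_fin])
    { toFun := fun n ↦ quadraticChar (ZMod p) n
      map_zero' := by rw [Nat.cast_zero, MulChar.map_zero]
      map_one' := by rw [Nat.cast_one, map_one]
      map_mul' := fun m n ↦ by rw [Nat.cast_mul, map_mul] }
    (fun q hq ↦ ?_) (fun q hq ↦ ?_) hn
  · change quadraticChar (ZMod p) q = -1 ∨ quadraticChar (ZMod p) q = 0 ∨
      quadraticChar (ZMod p) q = 1
    by_cases hq0 : (q : ZMod p) = 0
    · exact Or.inr (Or.inl (quadraticChar_eq_zero_iff.mpr hq0))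
    · exact (quadraticChar_dichotomy hq0).elim (fun h ↦ Or.inr (Or.inr h)) Or.inl
  · have : Fact q.Prime := ⟨hq⟩
    rw [card_absNorm_eq_prime_of_quadratic_basis b h0 h1 hq]
    change _ = 1 + quadraticChar (ZMod p) q
    rw [hval]
    exact card_sq_eq_sub_zmod hc

open NumberField in
lemma dedekindZeta_eq_riemannZeta_mul_LFunction {p c : ℕ} [Fact p.Prime] (hc : p + 1 = 4 * c)
    (K : Type*) [Field K] [NumberField K] (b : Basis (Fin 2) ℤ (𝓞 K))
    (h0 : b 0 = 1) (h1 : b 1 * b 1 = (1 : ℤ) • b 1 - (c : ℤ) • (1 : 𝓞 K))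
    {s : ℂ} (hs : 1 < s.re) :
    dedekindZeta K s = riemannZeta s * DirichletCharacter.LFunction
      ((quadraticChar (ZMod p)).ringHomComp (Int.castRingHom ℂ) : DirichletCharacter ℂ p) s := by
  set χ : DirichletCharacter ℂ p := (quadraticChar (ZMod p)).ringHomComp (Int.castRingHom ℂ)
  rw [DirichletCharacter.LFunction_eq_LSeries χ hs, ← LSeries_one_eq_riemannZeta hs,
    ← LSeries_convolution' (LSeriesSummable_one_iff.mpr hs)
      (DirichletCharacter.LSeriesSummable_of_one_lt_re χ hs), dedekindZeta]
  refine LSeries_congr (fun {n} hn ↦ ?_) s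
  rw [LSeries.convolution_def]
  simp only [Pi.one_apply, one_mul]
  rw [Nat.sum_divisorsAntidiagonal' (f := fun i j ↦ χ (j : ZMod p)) (n := n)]
  have := congrArg (Int.cast : ℤ → ℂ) (card_absNorm_eq_sum_quadraticChar hc b h0 h1 hn)
  rw [Int.cast_natCast, Int.cast_sum] at this
  exact this

open NumberField Filter Topology in
lemma dedekindZeta_residue_eq {p c : ℕ} [Fact p.Prime] (hc : p + 1 = 4 * c)
    (K : Type*) [Field K] [NumberField K] (b : Basis (Fin 2) ℤ (𝓞 K))
    (h0 : b 0 = 1) (h1 : b 1 * b 1 = (1 : ℤ) • b 1 - (c : ℤ) • (1 : 𝓞 K)) :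
    (dedekindZeta_residue K : ℂ) = DirichletCharacter.LFunction
      ((quadraticChar (ZMod p)).ringHomComp (Int.castRingHom ℂ) : DirichletCharacter ℂ p) 1 := by
  set χ : DirichletCharacter ℂ p :=
    (quadraticChar (ZMod p)).ringHomComp (Int.castRingHom ℂ) with hχdef
  have hchar : ringChar (ZMod p) ≠ 2 := by
    rw [ZMod.ringChar_zmod_n]
    omega
  have hχ : χ ≠ 1 :=
    (MulChar.ringHomComp_ne_one_iff (RingHom.injective_int _)).mpr (quadraticChar_ne_one hchar)
  have hofReal : Tendsto (fun s : ℝ ↦ (s : ℂ)) (𝓝[>] 1) (𝓝[≠] 1) := by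
    refine tendsto_nhdsWithin_iff.mpr ⟨?_, ?_⟩
    · exact (Complex.continuous_ofReal.tendsto' 1 1 Complex.ofReal_one).mono_left
        nhdsWithin_le_nhds
    · filter_upwards [self_mem_nhdsWithin] with s hs
      exact Complex.ofReal_ne_one.mpr (ne_of_gt hs)
  have hL : Tendsto (fun s : ℝ ↦ DirichletCharacter.LFunction χ s) (𝓝[>] 1)
      (𝓝 (DirichletCharacter.LFunction χ 1)) :=
    ((DirichletCharacter.differentiable_LFunction hχ).continuous.tendsto 1).comp
      (hofReal.mono_right nhdsWithin_le_nhds)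
  have hζ : Tendsto (fun s : ℝ ↦ ((s : ℂ) - 1) * riemannZeta s) (𝓝[>] 1) (𝓝 1) :=
    riemannZeta_residue_one.comp hofReal
  have hlim := hζ.mul hL
  rw [one_mul] at hlim
  refine tendsto_nhds_unique (tendsto_sub_one_mul_dedekindZeta_nhdsGT K)
    (hlim.congr' ?_)
  filter_upwards [self_mem_nhdsWithin] with s hs
  rw [dedekindZeta_eq_riemannZeta_mul_LFunction (p := p) hc K b h0 h1 (by simpa using hs),
    mul_assoc]

end ZetaFactorization

section ImaginaryQuadratic

open Module NumberField InfinitePlace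

variable {K : Type*} [Field K] [NumberField K]

lemma NumberField.isTotallyComplex_of_sq_eq_neg_natCast {n : ℕ} (hn : 0 < n) {α : K}
    (hα : α ^ 2 = -(n : K)) : IsTotallyComplex K := by
  refine ⟨fun v ↦ not_isReal_iff_isComplex.mp fun hv ↦ ?_⟩
  have h := congrArg (embedding_of_isReal hv) hα
  rw [map_pow, map_neg, map_natCast] at h
  have hn' : (0 : ℝ) < n := Nat.cast_pos.mpr hn
  nlinarith [sq_nonneg (embedding_of_isReal hv α)]

lemma NumberField.Units.regulator_eq_one_of_rank_eq_zero (h : Units.rank K = 0) :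
    Units.regulator K = 1 := by
  classical
  have hF : IsEmpty (Fin (Units.rank K)) := by rw [h]; infer_instance
  have : IsEmpty {w : InfinitePlace K // w ≠ Units.dirichletUnitTheorem.w₀} :=
    (Units.equivFinRank K).symm.isEmpty
  rw [Units.regulator_eq_det', Matrix.det_isEmpty, abs_one]

lemma NumberField.Units.rank_eq_zero_of_finrank_eq_two [IsTotallyComplex K]
    (h : finrank ℚ K = 2) : Units.rank K = 0 := by
  have h1 := IsTotallyComplex.finrank (K := K)
  have h2 := card_eq_nrRealPlaces_add_nrComplexPlaces (K := K)
  rw [IsTotallyComplex.nrRealPlaces_eq_zero] at h2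
  rw [Units.rank]
  omega

lemma torsionOrder_eq_two_of_quadratic_basis {c : ℕ} (hc : 2 ≤ c) (b : Basis (Fin 2) ℤ (𝓞 K))
    (h0 : b 0 = 1) (h1 : b 1 * b 1 = (1 : ℤ) • b 1 - (c : ℤ) • (1 : 𝓞 K)) :
    Units.torsionOrder K = 2 := by
  have hsq (u : (𝓞 K)ˣ) : u ^ 2 = 1 := by
    obtain ⟨x, y, hxy⟩ := exists_eq_of_quadratic_basis b h0 (u : 𝓞 K)
    have hN := Int.isUnit_iff.mp (u.isUnit.map (Algebra.norm ℤ))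
    rw [hxy, norm_of_quadratic_basis b h0 h1] at hN
    have hc' : (2 : ℤ) ≤ c := by exact_mod_cast hc
    have hy : y = 0 := by
      by_contra hy
      have : 1 ≤ y ^ 2 := by have := sq_pos_of_ne_zero hy; omega
      rcases hN with hN | hN <;> nlinarith [sq_nonneg (2 * x + y)]
    subst hy
    have hx : x ^ 2 = 1 := by
      rcases hN with hN | hN <;> nlinarith [sq_nonneg x]
    ext
    rw [Units.val_pow_eq_pow_val, hxy]
    simp only [zero_smul, add_zero, smul_pow, hx, one_pow, one_smul, Units.val_one]
  refine Nat.dvd_antisymm ?_ (Units.even_torsionOrder K).two_dvd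
  rw [Units.torsionOrder, ← IsCyclic.exponent_eq_card]
  exact Monoid.exponent_dvd_iff_forall_pow_eq_one.mpr fun u ↦ Subtype.ext (hsq u)

lemma classNumber_mul_eq_neg_sum_mul_quadraticChar {p : ℕ} [Fact p.Prime] (hp4 : p % 4 = 3)
    (hp : 3 < p) {α : K} (hα : α ^ 2 = -(p : K)) (hgen : Algebra.adjoin ℚ ({α} : Set K) = ⊤) :
    (p : ℤ) * classNumber K = -∑ b : ZMod p, (b.val : ℤ) * quadraticChar (ZMod p) b := by
  obtain ⟨c, hc⟩ : ∃ c, p + 1 = 4 * c := ⟨(p + 1) / 4, by omega⟩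
  have hp0 : 0 < p := by omega
  obtain ⟨b, h0, h1⟩ := exists_basis_ringOfIntegers_sqrt_neg Fact.out hc K α hα hgen
  have htc := isTotallyComplex_of_sq_eq_neg_natCast hp0 hα
  have hrank : finrank ℚ K = 2 := by
    rw [← RingOfIntegers.rank, finrank_eq_card_basis b, Fintype.card_fin]
  have hcomplex : nrComplexPlaces K = 1 := by
    have := IsTotallyComplex.finrank (K := K)
    omega
  have hdiscr : discr K = -p := by
    rw [← discr_eq_discr K b, discr_of_quadratic_basis b h0 h1]
    linarith [(by exact_mod_cast hc : (p : ℤ) + 1 = 4 * c)]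
  have hres := dedekindZeta_residue_def K
  rw [IsTotallyComplex.nrRealPlaces_eq_zero, hcomplex, hdiscr,
    Units.regulator_eq_one_of_rank_eq_zero (Units.rank_eq_zero_of_finrank_eq_two hrank),
    torsionOrder_eq_two_of_quadratic_basis (by omega) b h0 h1, Int.cast_neg, Int.cast_natCast,
    abs_neg, Nat.abs_cast] at hres
  have hL := dedekindZeta_residue_eq hc K b h0 h1
  rw [LFunction_quadraticChar_one hp4, hres] at hL
  have hsqrt : (Real.sqrt p : ℂ) ≠ 0 := by
    exact_mod_cast (Real.sqrt_pos.mpr (Nat.cast_pos.mpr hp0)).ne'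
  have hpC : (p : ℂ) ≠ 0 := Nat.cast_ne_zero.mpr hp0.ne'
  have hπ : (Real.pi : ℂ) ≠ 0 := Complex.ofReal_ne_zero.mpr Real.pi_ne_zero
  push_cast at hL
  field_simp at hL
  rw [← Int.cast_inj (α := ℂ)]
  push_cast
  linear_combination hL

end ImaginaryQuadratic

section FractionalParts

open Finset

lemma ZMod.fract_intCast_div (n : ℕ) [NeZero n] (m : ℤ) :
    Int.fract ((m : ℚ) / n) = ((m : ZMod n).val : ℚ) / n := by
  rw [Int.fract_div_intCast_eq_div_intCast_mod, ← Int.cast_natCast (ZMod.val _), ZMod.val_intCast]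

lemma Int.fract_add_fract_add_fract_eq_one_or_two {x y z : ℚ} {n : ℤ} (h : x + y + z = n)
    (hx : fract x ≠ 0) : fract x + fract y + fract z = 1 ∨ fract x + fract y + fract z = 2 := by
  have hm : fract x + fract y + fract z = ((n - ⌊x⌋ - ⌊y⌋ - ⌊z⌋ : ℤ) : ℚ) := by
    push_cast
    rw [← h]
    simp only [Int.fract]
    ring
  have h0 : 0 < fract x := lt_of_le_of_ne (fract_nonneg x) hx.symm
  have hlb : (0 : ℚ) < ((n - ⌊x⌋ - ⌊y⌋ - ⌊z⌋ : ℤ) : ℚ) := by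
    rw [← hm]
    linarith [fract_nonneg y, fract_nonneg z]
  have hub : ((n - ⌊x⌋ - ⌊y⌋ - ⌊z⌋ : ℤ) : ℚ) < (3 : ℤ) := by
    rw [← hm, Int.cast_ofNat]
    linarith [fract_lt_one x, fract_lt_one y, fract_lt_one z]
  rw [hm]
  generalize n - ⌊x⌋ - ⌊y⌋ - ⌊z⌋ = m at hlb hub
  have h1 : 0 < m := by exact_mod_cast hlb
  have h2 : m < 3 := by exact_mod_cast hub
  obtain rfl | rfl : m = 1 ∨ m = 2 := by omega
  · exact Or.inl (by norm_num)
  · exact Or.inr (by norm_num)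

lemma sum_quadraticChar_mul_comp_mul {F : Type*} [Field F] [Fintype F] [DecidableEq F]
    {M : Type*} [CommRing M] {r : F} (hr : r ≠ 0) (f : F → M) :
    ∑ x, (quadraticChar F x : M) * f (x * r) =
      quadraticChar F r * ∑ x, (quadraticChar F x : M) * f x := by
  rw [← Equiv.sum_comp (Equiv.mulRight₀ r hr) (fun x ↦ (quadraticChar F x : M) * f x), mul_sum]
  refine sum_congr rfl fun x _ ↦ ?_
  have h : (quadraticChar F r : M) * quadraticChar F r = 1 := by
    rw [← Int.cast_mul, ← sq, quadraticChar_sq_one hr, Int.cast_one]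
  rw [show Equiv.mulRight₀ r hr x = x * r from rfl, map_mul, Int.cast_mul]
  linear_combination -(quadraticChar F x : M) * f (x * r) * h

lemma sum_Icc_legendreSym_mul (p : ℕ) [Fact p.Prime] (f : ZMod p → ℚ) :
    ∑ a ∈ Icc 1 (p - 1), (legendreSym p (a : ℕ) : ℚ) * f (a : ℕ) =
      ∑ x : ZMod p, (quadraticChar (ZMod p) x : ℚ) * f x := by
  have hp := (Fact.out : p.Prime).pos
  rw [← sum_range_natCast_zmod p (fun x ↦ (quadraticChar (ZMod p) x : ℚ) * f x)]
  have hsub : Icc 1 (p - 1) ⊆ range p := fun a ha ↦ by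
    rw [mem_Icc] at ha
    rw [mem_range]
    omega
  simp only [legendreSym, Int.cast_natCast]
  refine sum_subset hsub fun a ha ha' ↦ ?_
  rw [mem_range] at ha
  rw [mem_Icc] at ha'
  obtain rfl : a = 0 := by omega
  rw [Nat.cast_zero, MulChar.map_zero, Int.cast_zero, zero_mul]

lemma sum_Icc_legendreSym_mul_fract (p : ℕ) [Fact p.Prime] {r : ℤ} (hr0 : 0 < r) (hrp : r < p) :
    ∑ a ∈ Icc 1 (p - 1), (legendreSym p (a : ℕ) : ℚ) * Int.fract ((a * r : ℚ) / p) =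
      legendreSym p r *
        ((∑ b : ZMod p, (b.val : ℤ) * quadraticChar (ZMod p) b : ℤ) / p) := by
  have hr : (r : ZMod p) ≠ 0 := by
    rw [Ne, ZMod.intCast_zmod_eq_zero_iff_dvd]
    exact fun h ↦ absurd (Int.le_of_dvd hr0 h) (not_le.mpr hrp)
  have hf (a : ℕ) : Int.fract ((a * r : ℚ) / p) =
      (fun x : ZMod p ↦ ((x * r).val : ℚ) / p) (a : ℕ) := by
    have := ZMod.fract_intCast_div p (a * r)
    push_cast at this
    exact this
  simp only [hf]
  rw [sum_Icc_legendreSym_mul p (fun x : ZMod p ↦ ((x * r).val : ℚ) / p),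
    sum_quadraticChar_mul_comp_mul hr (fun x : ZMod p ↦ (x.val : ℚ) / p), legendreSym]
  push_cast
  rw [sum_div]
  exact congrArg _ (sum_congr rfl fun b _ ↦ by ring)

lemma card_filter_sub_card_filter_eq_sum {ι : Type*} (s : Finset ι) (g : ι → ℚ) (χ : ι → ℤ)
    (hg : ∀ a ∈ s, g a = 1 ∨ g a = 2) (hχ : ∀ a ∈ s, χ a = 1 ∨ χ a = -1) :
    ((#{a ∈ s | g a = 1 ∧ χ a = 1} : ℚ) - #{a ∈ s | g a = 1 ∧ χ a = -1}) =
      ∑ a ∈ s, (χ a : ℚ) * (2 - g a) := by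
  rw [card_filter, card_filter]
  push_cast
  rw [← sum_sub_distrib]
  refine sum_congr rfl fun a ha ↦ ?_
  rcases hg a ha with h | h <;> rcases hχ a ha with h' | h' <;> rw [h, h'] <;> norm_num

end FractionalParts

/-- Let `p > 3` be a prime with `p ≡ 3 (mod 4)`, `h` the class number of `ℚ(√-p)` (formalized
as a number field `K` generated over `ℚ` by a square root `α` of `-p`), and `r, s, t` integers
with `0 < r, s, t < p` and `r + s + t = p`. With
`Φ = {a : 1 ≤ a ≤ p-1, ⟨ar/p⟩ + ⟨as/p⟩ + ⟨at/p⟩ = 1}`,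
`u = #{a ∈ Φ : (a|p) = 1}` and `v = #{a ∈ Φ : (a|p) = -1}`, one has
`u - v = h·((r|p) + (s|p) + (t|p))`. -/
theorem card_sub_card_eq_classNumber_mul (p : ℕ) [Fact p.Prime]
    (hp4 : p % 4 = 3) (hp : 3 < p)
    (K : Type) [Field K] [NumberField K] (α : K)
    (hα : α ^ 2 = -(p : K)) (hgen : Algebra.adjoin ℚ ({α} : Set K) = ⊤)
    (r s t : ℤ)
    (hr0 : 0 < r) (hrp : r < p) (hs0 : 0 < s) (hsp : s < p) (ht0 : 0 < t) (htp : t < p)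
    (hsum : r + s + t = p) :
    (((Finset.Icc 1 (p - 1)).filter (fun a : ℕ =>
        Int.fract ((a * r : ℚ) / p) + Int.fract ((a * s : ℚ) / p)
          + Int.fract ((a * t : ℚ) / p) = 1 ∧ legendreSym p a = 1)).card : ℤ)
      - (((Finset.Icc 1 (p - 1)).filter (fun a : ℕ =>
          Int.fract ((a * r : ℚ) / p) + Int.fract ((a * s : ℚ) / p)
            + Int.fract ((a * t : ℚ) / p) = 1 ∧ legendreSym p a = -1)).card : ℤ)
      = (NumberField.classNumber K : ℤ)
          * (legendreSym p r + legendreSym p s + legendreSym p t) := by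
  have hp0 : (p : ℚ) ≠ 0 := Nat.cast_ne_zero.mpr (by omega)
  have hne (a : ℕ) (ha : a ∈ Finset.Icc 1 (p - 1)) : ((a : ℤ) : ZMod p) ≠ 0 := by
    rw [Finset.mem_Icc] at ha
    rw [Int.cast_natCast, Ne, ZMod.natCast_eq_zero_iff]
    exact fun h ↦ absurd (Nat.le_of_dvd ha.1 h) (by omega)
  have hr : (r : ZMod p) ≠ 0 := by
    rw [Ne, ZMod.intCast_zmod_eq_zero_iff_dvd]
    exact fun h ↦ absurd (Int.le_of_dvd hr0 h) (not_le.mpr hrp)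
  have hcard := card_filter_sub_card_filter_eq_sum (Finset.Icc 1 (p - 1))
    (fun a : ℕ ↦ Int.fract ((a * r : ℚ) / p) + Int.fract ((a * s : ℚ) / p)
      + Int.fract ((a * t : ℚ) / p)) (fun a ↦ legendreSym p a)
    (fun a ha ↦ by
      refine Int.fract_add_fract_add_fract_eq_one_or_two (n := a) ?_ ?_
      · rw [← add_div, ← add_div, ← mul_add, ← mul_add, div_eq_iff hp0]
        exact_mod_cast congrArg (fun x : ℤ ↦ (a : ℤ) * x) hsum
      · have h := ZMod.fract_intCast_div p (a * r)
        push_cast at h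
        rw [h]
        refine div_ne_zero (Nat.cast_ne_zero.mpr ?_) hp0
        rw [Ne, ZMod.val_eq_zero]
        exact mul_ne_zero (by simpa using hne a ha) hr)
    (fun a ha ↦ legendreSym.eq_one_or_neg_one p (hne a ha))
  have hχ0 := sum_Icc_legendreSym_mul p (fun _ ↦ 2)
  rw [← Finset.sum_mul Finset.univ, ← Int.cast_sum, quadraticChar_sum_zero (by
    rw [ZMod.ringChar_zmod_n]; omega), Int.cast_zero, zero_mul] at hχ0
  simp only [mul_sub, mul_add, Finset.sum_sub_distrib, Finset.sum_add_distrib] at hcard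
  rw [hχ0, sum_Icc_legendreSym_mul_fract p hr0 hrp, sum_Icc_legendreSym_mul_fract p hs0 hsp,
    sum_Icc_legendreSym_mul_fract p ht0 htp] at hcard
  have hS := congrArg (fun x : ℤ ↦ (-x : ℚ) / p)
    (classNumber_mul_eq_neg_sum_mul_quadraticChar hp4 hp hα hgen)
  simp only [Int.cast_neg, neg_neg, Int.cast_mul, Int.cast_natCast] at hS
  rw [← hS] at hcard
  rw [← Int.cast_inj (α := ℚ)]
  push_cast
  rw [hcard]
  field_simp
  ring
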